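/- Let e be an integer with e ≥ 9. Then the equation (4^e−1)^x + 4^{e·y} + (4^e+1)^z = (4^e+2)^w has no solution in positive integers x, y, z, w. -/

import Mathlib

/-! ### Divisibility of interpolation determinants -/

lemma det_dvd_aux {ι τ : Type*} [Fintype ι] [DecidableEq ι] [Fintype τ] [DecidableEq τ]
    (P : ℤ) (wt : τ → ℕ) (T : ℕ) (B : ι → τ → ℤ) (A : τ → ι → ℤ)
    (hA : ∀ t c, P ^ (wt t) ∣ A t c)
    (hT : ∀ φ : ι → τ, Function.Injective φ → T ≤ ∑ c, wt (φ c))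
    (M : Matrix ι ι ℤ) (hM : ∀ j c, M j c = ∑ t, B j t * A t c) : P ^ T ∣ M.det := by
  have h1 : M.det = Matrix.detRowAlternating.toMultilinearMap
      (fun c => ∑ t, (A t c • (fun j => B j t) : ι → ℤ)) := by
    rw [← Matrix.det_transpose]
    show Matrix.det _ = Matrix.det _
    congr 1
    ext c j
    simp [Matrix.transpose_apply, hM, Finset.sum_apply, mul_comm]
  rw [h1, MultilinearMap.map_sum]
  apply Finset.dvd_sum
  intro φ _
  rw [MultilinearMap.map_smul_univ]
  by_cases hφ : Function.Injective φ
  · apply Dvd.dvd.mul_right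
    calc P ^ T ∣ P ^ (∑ c, wt (φ c)) := pow_dvd_pow _ (hT φ hφ)
      _ = ∏ c, P ^ (wt (φ c)) := by rw [Finset.prod_pow_eq_pow_sum]
      _ ∣ _ := Finset.prod_dvd_prod_of_dvd _ _ (fun c _ => hA _ _)
  · rw [Function.Injective] at hφ
    push Not at hφ
    obtain ⟨i, j, hij, hne⟩ := hφ
    have : (Matrix.detRowAlternating.toMultilinearMap
      (fun c => (fun j => B j (φ c) : ι → ℤ))) = 0 := by
      show Matrix.detRowAlternating _ = 0
      exact AlternatingMap.map_eq_zero_of_eq _ _ (by simp [hij]) hne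
    simp only [this, smul_zero, dvd_zero]

lemma weight_sum_aux {ι : Type*} [Fintype ι] [DecidableEq ι] (D K V : ℕ)
    (hV : Fintype.card ι ≤ V + K) (φ : ι → Fin D ⊕ ι) (hφ : Function.Injective φ) :
    ∑ h ∈ Finset.range (Fintype.card ι - K), (Fintype.card ι - K - h) ≤
      ∑ c, (Sum.elim (fun m : Fin D => (m : ℕ) + 1 - K) (fun _ => V) (φ c)) := by
  set N := Fintype.card ι with hN
  set wt : Fin D ⊕ ι → ℕ := Sum.elim (fun m : Fin D => (m : ℕ) + 1 - K) (fun _ => V) with hwt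
  have h1 : ∀ c, ∑ h ∈ Finset.range (N - K), (if h + 1 ≤ wt (φ c) then 1 else 0) ≤ wt (φ c) := by
    intro c
    rw [← Finset.card_filter]
    calc _ ≤ (Finset.range (wt (φ c))).card := by
          apply Finset.card_le_card
          intro h
          simp
      _ = _ := by simp
  calc _ ≤ ∑ h ∈ Finset.range (N - K), ∑ c, (if h + 1 ≤ wt (φ c) then 1 else 0) := ?_
    _ = ∑ c, ∑ h ∈ Finset.range (N - K), (if h + 1 ≤ wt (φ c) then 1 else 0) := Finset.sum_comm
    _ ≤ _ := Finset.sum_le_sum (fun c _ => h1 c)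
  apply Finset.sum_le_sum
  intro h hh
  rw [Finset.mem_range] at hh
  rw [← Finset.card_filter]
  have h2 : (Finset.univ.filter (fun c => ¬ (h + 1 ≤ wt (φ c)))).card ≤ K + h := by
    have : ((Finset.univ.filter (fun c => ¬ (h + 1 ≤ wt (φ c)))).image
        (fun c => Sum.elim (fun m : Fin D => (m : ℕ)) (fun _ => 0) (φ c))).card ≤
        (Finset.range (K + h)).card := by
      apply Finset.card_le_card
      intro m hm
      simp only [Finset.mem_image, Finset.mem_filter, Finset.mem_univ, true_and] at hm
      obtain ⟨c, hc, rfl⟩ := hm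
      rcases hφc : φ c with m | i
      · simp [hφc, hwt] at hc ⊢
        omega
      · simp [hφc, hwt] at hc ⊢
        omega
    rw [Finset.card_range, Finset.card_image_of_injOn] at this
    · exact this
    · intro c hc c' hc' hcc
      simp only [Finset.coe_filter, Finset.mem_univ, true_and, Set.mem_ofPred_eq] at hc hc'
      apply hφ
      rcases hφc : φ c with m | i
      · rcases hφc' : φ c' with m' | i'
        · simp [hφc, hφc'] at hcc
          rw [Fin.ext hcc]
        · simp [hφc', hwt] at hc'
          omega
      · simp [hφc, hwt] at hc
        omega
  have h3 := Finset.card_filter_add_card_filter_not (s := (Finset.univ : Finset ι))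
    (fun c => h + 1 ≤ wt (φ c))
  rw [Finset.card_univ] at h3
  omega

lemma newton_aux (P c : ℤ) (k : ℕ) : ∃ A : ℕ → ℤ, (∀ m, P ^ (m - k) ∣ A m) ∧
    ∀ ξ D : ℕ, ξ < D → (ξ : ℤ) ^ k * (1 + P * c) ^ ξ =
      ∑ m ∈ Finset.range D, ((ξ.choose m : ℕ) : ℤ) * A m := by
  induction k with
  | zero =>
    refine ⟨fun m => (P * c) ^ m, fun m => ?_, fun ξ D h => ?_⟩
    · simp only [Nat.sub_zero, mul_pow]
      exact Dvd.intro _ rfl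
    · rw [add_comm, add_pow, pow_zero, one_mul]
      rw [← Finset.sum_subset (Finset.range_subset_range.2 (Nat.succ_le_of_lt h))]
      · apply Finset.sum_congr rfl
        intros
        simp [mul_comm]
      · intro m _ hm
        rw [Finset.mem_range, not_lt] at hm
        rw [Nat.choose_eq_zero_of_lt (by omega)]
        simp
  | succ k ih =>
    obtain ⟨A, hA, hs⟩ := ih
    refine ⟨fun m => m * A (m - 1) + m * A m, fun m => ?_, fun ξ D h => ?_⟩
    · apply dvd_add
      · apply Dvd.dvd.mul_left
        have := hA (m - 1)
        rwa [show m - 1 - k = m - (k + 1) by omega] at this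
      · apply Dvd.dvd.mul_left
        exact (pow_dvd_pow _ (by omega)).trans (hA m)
    · rw [pow_succ, mul_right_comm, hs ξ D h]
      obtain ⟨D, rfl⟩ : ∃ D', D = D' + 1 := ⟨D - 1, by omega⟩
      have e1 : ∀ m, ((ξ.choose m : ℕ) : ℤ) * A m * ξ =
          ((ξ.choose (m + 1) : ℕ) : ℤ) * (((m + 1 : ℕ) : ℤ) * A m) + (ξ.choose m : ℕ) * (m * A m) := by
        intro m
        have h1 : ξ.choose m * ξ = ξ.choose (m + 1) * (m + 1) + ξ.choose m * m := by
          rcases le_or_gt m ξ with hm | hm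
          · rw [Nat.choose_succ_right_eq, ← Nat.mul_add]
            congr 1
            omega
          · rw [Nat.choose_eq_zero_of_lt hm, Nat.choose_eq_zero_of_lt (by omega)]
            simp
        have h2 : ((ξ.choose m : ℕ) : ℤ) * ξ = (ξ.choose (m + 1) : ℕ) * ((m + 1 : ℕ) : ℤ) +
            (ξ.choose m : ℕ) * m := by exact_mod_cast h1
        linear_combination A m * h2
      rw [Finset.sum_mul, Finset.sum_congr rfl (fun m _ => e1 m), Finset.sum_add_distrib]
      simp only [mul_add, Finset.sum_add_distrib]
      congr 1
      rw [Finset.sum_range_succ, Finset.sum_range_succ', Nat.choose_eq_zero_of_lt h]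
      simp

/-! ### The zero estimate -/

open Polynomial in
lemma zero_est_aux (K L R S y z : ℕ) (a b : ℤ) (ha : 2 ≤ |a|) (hb : b ≠ 0)
    (hRS : (K - 1) * L < R * S)
    (hinj : ∀ r s r' s' : ℕ, r < R → s < S → r' < R → s' < S →
      r * y + s * z = r' * y + s' * z → r = r' ∧ s = s')
    (c : Fin K × Fin L → ℚ)
    (h : ∀ r s : ℕ, r < R + L → s < S →
      ∑ q : Fin K × Fin L, c q *
        (((r * y + s * z : ℕ) : ℚ) ^ (q.1 : ℕ) * (((a ^ r * b ^ s : ℤ) : ℚ)) ^ (q.2 : ℕ)) = 0) :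
    c = 0 := by
  classical
  by_contra hc
  let Q : Fin L → ℚ[X] := fun l => ∑ k : Fin K, C (c (k, l)) * X ^ (k : ℕ)
  have hQeval : ∀ l t, (Q l).eval t = ∑ k : Fin K, c (k, l) * t ^ (k : ℕ) := by
    intro l t
    simp [Q, eval_finsetSum]
  have hQcoeff : ∀ l (k : Fin K), (Q l).coeff k = c (k, l) := by
    intro l k
    simp only [Q, finsetSum_coeff, coeff_C_mul, coeff_X_pow, mul_ite, mul_one, mul_zero]
    rw [Finset.sum_eq_single k]
    · simp
    · intro k' _ hk'
      rw [if_neg]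
      intro hh
      exact hk' (Fin.ext hh.symm)
    · simp
  have hQdeg : ∀ l, (Q l).natDegree ≤ K - 1 := by
    intro l
    apply natDegree_sum_le_of_forall_le
    intro k _
    exact (natDegree_C_mul_X_pow_le _ _).trans (by omega)
  let Λ : Finset (Fin L) := Finset.univ.filter (fun l => Q l ≠ 0)
  let L' := Λ.card
  have hL' : L' ≤ L := by
    have := Finset.card_le_univ Λ
    simpa using this
  let ℓ : Fin L' ↪o Fin L := Λ.orderEmbOfFin rfl
  have hℓ : ∀ i, Q (ℓ i) ≠ 0 := by
    intro i
    have := Finset.orderEmbOfFin_mem Λ rfl i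
    exact (Finset.mem_filter.1 this).2
  have hL'pos : 0 < L' := by
    rw [Finset.card_pos]
    by_contra hne
    rw [Finset.not_nonempty_iff_eq_empty] at hne
    apply hc
    ext ⟨k, l⟩
    have : l ∉ Λ := by simp [hne]
    simp only [Λ, Finset.mem_filter, Finset.mem_univ, true_and, not_not] at this
    rw [← hQcoeff l k, this]
    simp
  let M : Matrix (Fin L') (Fin L') ℚ[X] := fun j i =>
    C ((((a : ℚ) ^ ((ℓ i : Fin L) : ℕ))) ^ (j : ℕ)) * taylor (((j : ℕ) * y : ℕ) : ℚ) (Q (ℓ i))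
  have ha0 : (a : ℚ) ≠ 0 := by
    have : a ≠ 0 := by
      rintro rfl
      simp at ha
    exact_mod_cast this
  let d := ∑ i, (Q (ℓ i)).natDegree
  have hd : d ≤ (K - 1) * L := by
    calc d ≤ ∑ i : Fin L', (K - 1) := Finset.sum_le_sum (fun i _ => hQdeg _)
      _ = L' * (K - 1) := by simp
      _ ≤ _ := by rw [mul_comm]; exact Nat.mul_le_mul_left _ hL'
  have hMne : ∀ j i, M j i ≠ 0 := by
    intro j i
    apply mul_ne_zero
    · rw [Ne, C_eq_zero]
      positivity
    · rw [Ne, map_eq_zero_iff _ (taylor_injective _)]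
      exact hℓ i
  have hMdeg : ∀ j i, (M j i).natDegree = (Q (ℓ i)).natDegree := by
    intro j i
    rw [natDegree_C_mul (by positivity), natDegree_taylor]
  have hMlead : ∀ j i, (M j i).leadingCoeff =
      (((a : ℚ) ^ ((ℓ i : Fin L) : ℕ))) ^ (j : ℕ) * (Q (ℓ i)).leadingCoeff := by
    intro j i
    simp only [M]
    rw [leadingCoeff_mul, leadingCoeff_C, leadingCoeff_taylor]
  have hprod : ∀ σ : Equiv.Perm (Fin L'), (∏ i, M (σ i) i).natDegree = d := by
    intro σ
    rw [natDegree_prod _ _ (fun i _ => hMne _ _)]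
    simp [hMdeg, d]
  have hcoeff : M.det.coeff d = (Matrix.vandermonde
      (fun i : Fin L' => (a : ℚ) ^ ((ℓ i : Fin L) : ℕ))).det * ∏ i, (Q (ℓ i)).leadingCoeff := by
    rw [Matrix.det_apply, ← Matrix.det_transpose, Matrix.det_apply, finsetSum_coeff,
      Finset.sum_mul]
    apply Finset.sum_congr rfl
    intro σ _
    rw [coeff_smul, smul_mul_assoc]
    congr 1
    rw [← hprod σ, coeff_natDegree, leadingCoeff_prod, ← Finset.prod_mul_distrib]
    apply Finset.prod_congr rfl
    intro i _
    rw [hMlead]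
    rfl
  have hdetne : M.det ≠ 0 := by
    intro h0
    rw [h0, coeff_zero] at hcoeff
    have h1 : (Matrix.vandermonde
      (fun i : Fin L' => (a : ℚ) ^ ((ℓ i : Fin L) : ℕ))).det ≠ 0 := by
      rw [Matrix.det_vandermonde_ne_zero_iff]
      intro i i' hii
      simp only at hii
      have h2 : |(a : ℚ)| ^ ((ℓ i : Fin L) : ℕ) = |(a : ℚ)| ^ ((ℓ i' : Fin L) : ℕ) := by
        rw [← abs_pow, ← abs_pow, hii]
      have h3 : (1 : ℚ) < |(a : ℚ)| := by
        have : (2 : ℚ) ≤ |(a : ℚ)| := by exact_mod_cast ha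
        linarith
      have h4 := pow_right_injective₀ (by linarith) (ne_of_gt h3) h2
      exact ℓ.injective (Fin.ext h4)
    have h2 : ∏ i, (Q (ℓ i)).leadingCoeff ≠ 0 :=
      Finset.prod_ne_zero_iff.2 (fun i _ => leadingCoeff_ne_zero.2 (hℓ i))
    exact mul_ne_zero h1 h2 hcoeff.symm
  have hdetdeg : M.det.natDegree ≤ d := by
    rw [Matrix.det_apply]
    apply natDegree_sum_le_of_forall_le
    intro σ _
    exact (natDegree_smul_le _ _).trans (hprod σ).le
  have hroot : ∀ r s : ℕ, r < R → s < S → M.det.eval (((r * y + s * z : ℕ) : ℚ)) = 0 := by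
    intro r s hr hs
    rw [← coe_evalRingHom, RingHom.map_det]
    rw [← Matrix.exists_mulVec_eq_zero_iff]
    refine ⟨fun i => (((a ^ r * b ^ s : ℤ) : ℚ)) ^ ((ℓ i : Fin L) : ℕ), ?_, ?_⟩
    · intro h0
      have := congrFun h0 ⟨0, hL'pos⟩
      simp only [Pi.zero_apply] at this
      have hb0 : (b : ℚ) ≠ 0 := by exact_mod_cast hb
      push_cast at this
      have h5 : (a : ℚ) ^ r * (b : ℚ) ^ s ≠ 0 := by positivity
      exact pow_ne_zero _ h5 this
    · ext j
      have h1 := h (r + j) s (by have := j.2; omega) hs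
      rw [Fintype.sum_prod_type_right] at h1
      have h2 : ∀ l : Fin L, ∑ k : Fin K, c (k, l) * ((((r + j) * y + s * z : ℕ) : ℚ) ^ (k : ℕ) *
          (((a ^ (r + (j : ℕ)) * b ^ s : ℤ) : ℚ)) ^ (l : ℕ)) =
          (Q l).eval (((r + j) * y + s * z : ℕ) : ℚ) *
          (((a ^ (r + (j : ℕ)) * b ^ s : ℤ) : ℚ)) ^ (l : ℕ) := by
        intro l
        rw [hQeval, Finset.sum_mul]
        apply Finset.sum_congr rfl
        intros
        ring
      rw [Finset.sum_congr rfl (fun l _ => h2 l)] at h1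
      simp only [Matrix.mulVec, dotProduct, Pi.zero_apply, RingHom.mapMatrix_apply,
        Matrix.map_apply]
      rw [← h1, ← Finset.sum_subset (Finset.subset_univ Λ)]
      · have h3 : Λ = Finset.univ.map ℓ.toEmbedding := by
          ext l
          have := Finset.range_orderEmbOfFin Λ rfl
          rw [Set.ext_iff] at this
          rw [← Finset.mem_coe, ← this l]
          simp only [Finset.mem_map, Finset.mem_univ, true_and, Set.mem_range]
          rfl
        have h4 : ∀ f : Fin L → ℚ, ∑ l ∈ Λ, f l = ∑ i : Fin L', f (ℓ i) := by
          intro f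
          conv_lhs => rw [h3]
          rw [Finset.sum_map]
          rfl
        rw [h4]
        apply Finset.sum_congr rfl
        intro i _
        simp only [M, coe_evalRingHom, eval_mul, eval_C, taylor_eval]
        have e1 : ((r * y + s * z : ℕ) : ℚ) + (((j : ℕ) * y : ℕ) : ℚ) =
          (((r + j) * y + s * z : ℕ) : ℚ) := by push_cast; ring
        rw [e1]
        push_cast
        ring
      · intro l _ hl
        simp only [Λ, Finset.mem_filter, Finset.mem_univ, true_and, not_not] at hl
        rw [hl]
        simp
  apply hdetne
  let pts : Finset ℚ := (Finset.range R ×ˢ Finset.range S).image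
    (fun p => ((p.1 * y + p.2 * z : ℕ) : ℚ))
  have hcard : pts.card = R * S := by
    rw [Finset.card_image_of_injOn]
    · simp
    · rintro ⟨r, s⟩ h1 ⟨r', s'⟩ h2 h3
      simp only [Finset.coe_product, Finset.coe_range, Set.mem_prod, Set.mem_Iio] at h1 h2
      simp only at h3
      have h3' : r * y + s * z = r' * y + s' * z := by exact_mod_cast h3
      have := hinj r s r' s' h1.1 h1.2 h2.1 h2.2 h3'
      rw [this.1, this.2]
  apply eq_zero_of_natDegree_lt_card_of_eval_eq_zero' _ pts
  · intro t ht
    simp only [pts, Finset.mem_image, Finset.mem_product, Finset.mem_range] at ht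
    obtain ⟨⟨r, s⟩, ⟨hr, hs⟩, rfl⟩ := ht
    exact hroot r s hr hs
  · rw [hcard]
    omega

/-! ### The interpolation inequality -/

lemma exists_minor_aux {ι κ : Type} [Fintype ι] [DecidableEq ι] [Fintype κ] (v : κ → ι → ℚ)
    (h : ∀ c : ι → ℚ, (∀ p, ∑ q, c q * v p q = 0) → c = 0) :
    ∃ f : ι → κ, (Matrix.of (fun j q => v (f j) q)).det ≠ 0 := by
  have hspan : Submodule.span ℚ (Set.range v) = ⊤ := by
    by_contra hne
    obtain ⟨f, hf, hle⟩ := Submodule.exists_le_ker_of_lt_top _ (lt_top_iff_ne_top.2 hne)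
    apply hf
    have h1 := h (fun q => f (Pi.single q 1)) (by
      intro p
      have h2 : f (v p) = 0 := hle (Submodule.subset_span ⟨p, rfl⟩)
      rw [LinearMap.pi_apply_eq_sum_univ f (v p)] at h2
      rw [← h2]
      apply Finset.sum_congr rfl
      intro q _
      rw [smul_eq_mul, mul_comm]
      congr 2
      ext i
      simp [Pi.single_apply, eq_comm])
    apply LinearMap.pi_ext'
    intro q
    ext
    simpa using congrFun h1 q
  obtain ⟨κ', g, hg, hgs, hgl⟩ := exists_linearIndependent' ℚ v
  rw [hspan] at hgs
  have bs : Module.Basis κ' ℚ (ι → ℚ) := Module.Basis.mk hgl hgs.ge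
  have : Fintype κ' := FiniteDimensional.fintypeBasisIndex bs
  have hcard : Fintype.card κ' = Fintype.card ι := by
    rw [← Module.finrank_eq_card_basis bs, Module.finrank_fintype_fun_eq_card]
  let e : ι ≃ κ' := (Fintype.equivOfCardEq hcard).symm
  refine ⟨fun j => g (e j), ?_⟩
  have h1 : LinearIndependent ℚ (fun j => v (g (e j))) := hgl.comp e e.injective
  have h2 : IsUnit (Matrix.of (fun j q => v (g (e j)) q)) := by
    rw [← Matrix.linearIndependent_rows_iff_isUnit]
    exact h1
  rw [Matrix.isUnit_iff_isUnit_det] at h2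
  exact h2.ne_zero

lemma det_abs_le_aux {ι : Type*} [Fintype ι] [DecidableEq ι] (M : Matrix ι ι ℤ) (u : ι → ℤ)
    (h : ∀ j q, |M j q| ≤ u q) : |M.det| ≤ (Fintype.card ι).factorial * ∏ q, u q := by
  rw [Matrix.det_apply]
  calc _ ≤ ∑ σ : Equiv.Perm ι, |Equiv.Perm.sign σ • ∏ i, M (σ i) i| :=
        Finset.abs_sum_le_sum_abs _ _
    _ ≤ ∑ σ : Equiv.Perm ι, ∏ q, u q := by
        apply Finset.sum_le_sum
        intro σ _
        have : |Equiv.Perm.sign σ • ∏ i, M (σ i) i| = ∏ i, |M (σ i) i| := by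
          rw [← Finset.abs_prod]
          rcases Int.units_eq_one_or (Equiv.Perm.sign σ) with h | h <;> simp [h]
        rw [this]
        exact Finset.prod_le_prod (fun _ _ => abs_nonneg _) (fun i _ => h _ _)
    _ = _ := by simp [Finset.card_univ, Fintype.card_perm]

lemma interp_bound (P G a b : ℤ) (y z K L R S V X : ℕ) (H : ℤ) (hG : P ∣ G - 1)
    (ha : P ^ V ∣ a - G ^ y) (hb : P ^ V ∣ b - G ^ z) (ha2 : 2 ≤ |a|) (hb0 : b ≠ 0)
    (hRS : (K - 1) * L < R * S)
    (hinj : ∀ r s r' s' : ℕ, r < R → s < S → r' < R → s' < S →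
      r * y + s * z = r' * y + s' * z → r = r' ∧ s = s')
    (hV : K * L ≤ V + K)
    (hX : (R + L) * y + S * z ≤ X) (hH : |a| ^ (R + L) * |b| ^ S ≤ H) :
    P ^ (∑ h ∈ Finset.range (K * L - K), (K * L - K - h)) ≤
      ((K * L).factorial : ℤ) * ∏ q : Fin K × Fin L, ((X : ℤ) ^ (q.1 : ℕ) * H ^ (q.2 : ℕ)) := by
  classical
  let ξ : Fin (R + L) × Fin S → ℕ := fun p => (p.1 : ℕ) * y + (p.2 : ℕ) * z
  let η : Fin (R + L) × Fin S → ℤ := fun p => a ^ (p.1 : ℕ) * b ^ (p.2 : ℕ)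
  have hξX : ∀ p, ξ p ≤ X := by
    intro p
    have h1 : (p.1 : ℕ) * y ≤ (R + L) * y := Nat.mul_le_mul_right _ p.1.2.le
    have h2 : (p.2 : ℕ) * z ≤ S * z := Nat.mul_le_mul_right _ p.2.2.le
    simp only [ξ]
    omega
  have hηH : ∀ p, |η p| ≤ H := by
    intro p
    simp only [η]
    rw [abs_mul, abs_pow, abs_pow]
    refine le_trans ?_ hH
    have hb1 : 1 ≤ |b| := Int.one_le_abs hb0
    apply mul_le_mul
    · exact pow_le_pow_right₀ (by omega) p.1.2.le
    · exact pow_le_pow_right₀ hb1 p.2.2.le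
    · positivity
    · positivity
  obtain ⟨f, hf⟩ := exists_minor_aux (ι := Fin K × Fin L)
    (fun (p : Fin (R + L) × Fin S) (q : Fin K × Fin L) =>
      ((ξ p : ℕ) : ℚ) ^ (q.1 : ℕ) * ((η p : ℤ) : ℚ) ^ (q.2 : ℕ)) (by
    intro c hc
    apply zero_est_aux K L R S y z a b ha2 hb0 hRS hinj c
    intro r s hr hs
    exact hc (⟨r, hr⟩, ⟨s, hs⟩))
  let M : Matrix (Fin K × Fin L) (Fin K × Fin L) ℤ := Matrix.of fun j q =>
    ((ξ (f j) : ℕ) : ℤ) ^ (q.1 : ℕ) * (η (f j)) ^ (q.2 : ℕ)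
  have hMdet : M.det ≠ 0 := by
    intro h0
    apply hf
    have h1 : (Matrix.of (fun j q => ((ξ (f j) : ℕ) : ℚ) ^ (q.1 : ℕ) *
        ((η (f j) : ℤ) : ℚ) ^ (q.2 : ℕ))) = (Int.castRingHom ℚ).mapMatrix M := by
      ext j q
      simp [M]
    rw [h1, ← RingHom.map_det, h0, map_zero]
  -- divisibility
  obtain ⟨g, hg⟩ := hG
  have hGl : ∀ l : ℕ, ∃ c : ℤ, G ^ l = 1 + P * c := by
    intro l
    have h1 : P ∣ G ^ l - 1 := by
      have := sub_dvd_pow_sub_pow G 1 l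
      rw [one_pow] at this
      exact (Dvd.intro _ hg.symm).trans this
    obtain ⟨c, hc⟩ := h1
    exact ⟨c, by linarith⟩
  choose cl hcl using hGl
  choose A hA1 hA2 using fun q : Fin K × Fin L => newton_aux P (cl q.2) q.1
  have hcong : ∀ j (q : Fin K × Fin L), P ^ V ∣ M j q -
      ((ξ (f j) : ℕ) : ℤ) ^ (q.1 : ℕ) * (1 + P * cl q.2) ^ (ξ (f j)) := by
    intro j q
    have h1 : η (f j) ≡ G ^ (ξ (f j)) [ZMOD P ^ V] := by
      have ha' : a ≡ G ^ y [ZMOD P ^ V] := (Int.modEq_iff_dvd.2 ha).symm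
      have hb' : b ≡ G ^ z [ZMOD P ^ V] := (Int.modEq_iff_dvd.2 hb).symm
      have := (ha'.pow ((f j).1 : ℕ)).mul (hb'.pow ((f j).2 : ℕ))
      rw [← pow_mul, ← pow_mul, ← pow_add] at this
      simp only [η, ξ]
      rw [mul_comm ((f j).1 : ℕ) y, mul_comm ((f j).2 : ℕ) z]
      exact this
    have h2 := (h1.pow (q.2 : ℕ)).mul_left (((ξ (f j) : ℕ) : ℤ) ^ (q.1 : ℕ))
    rw [← hcl, ← pow_mul, mul_comm (q.2 : ℕ), pow_mul]
    exact Int.modEq_iff_dvd.1 h2.symm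
  choose E hE using hcong
  have hcard : Fintype.card (Fin K × Fin L) = K * L := by simp
  have hdvd : P ^ (∑ h ∈ Finset.range (K * L - K), (K * L - K - h)) ∣ M.det := by
    apply det_dvd_aux P (Sum.elim (fun m : Fin (X + 1) => (m : ℕ) + 1 - K)
        (fun _ : Fin K × Fin L => V)) _
      (fun j t => Sum.elim (fun m : Fin (X + 1) => (((ξ (f j)).choose m : ℕ) : ℤ))
        (fun q' => E j q') t)
      (fun t q => Sum.elim (fun m : Fin (X + 1) => A q m)
        (fun q' => if q' = q then P ^ V else 0) t)
    · rintro (m | q') q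
      · simp only [Sum.elim_inl]
        exact (pow_dvd_pow _ (by have := q.1.2; omega)).trans (hA1 q m)
      · simp only [Sum.elim_inr]
        split_ifs <;> simp
    · intro φ hφ
      have := weight_sum_aux (X + 1) K V (by rw [hcard]; exact hV) φ hφ
      rwa [hcard] at this
    · intro j q
      rw [Fintype.sum_sum_type]
      simp only [Sum.elim_inl, Sum.elim_inr, mul_ite, mul_zero, Finset.sum_ite_eq',
        Finset.mem_univ, if_true]
      rw [Fin.sum_univ_eq_sum_range (fun m => (((ξ (f j)).choose m : ℕ) : ℤ) * A q m) (X + 1),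
        ← hA2 q (ξ (f j)) (X + 1) (Nat.lt_succ_of_le (hξX _))]
      linear_combination hE j q
  calc _ ≤ |M.det| := Int.le_of_dvd (abs_pos.2 hMdet) ((dvd_abs _ _).2 hdvd)
    _ ≤ _ := by
      have := det_abs_le_aux M (fun q => (X : ℤ) ^ (q.1 : ℕ) * H ^ (q.2 : ℕ)) (by
        intro j q
        simp only [M, Matrix.of_apply]
        rw [abs_mul, abs_pow, abs_pow]
        apply mul_le_mul
        · apply pow_le_pow_left₀ (abs_nonneg _)
          rw [Nat.abs_cast]
          exact_mod_cast hξX _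
        · exact pow_le_pow_left₀ (abs_nonneg _) (hηH _) _
        · positivity
        · positivity)
      rwa [hcard] at this

/-! ### An explicit two-logarithm estimate -/

lemma inj_points_aux (y z R S : ℕ) (hyz : Nat.Coprime y z) (hy : 0 < y) (hz : 0 < z)
    (h : R ≤ z ∨ S ≤ y) : ∀ r s r' s' : ℕ, r < R → s < S → r' < R → s' < S →
      r * y + s * z = r' * y + s' * z → r = r' ∧ s = s' := by
  intro r s r' s' hr hs hr' hs' heq
  have e1 : ((r : ℤ) - r') * y = ((s' : ℤ) - s) * z := by
    have : ((r * y + s * z : ℕ) : ℤ) = ((r' * y + s' * z : ℕ) : ℤ) := by rw [heq]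
    push_cast at this
    linarith
  have hcop : IsCoprime (y : ℤ) (z : ℤ) := Nat.isCoprime_iff_coprime.2 hyz
  have hy' : (y : ℤ) ≠ 0 := by positivity
  have hz' : (z : ℤ) ≠ 0 := by positivity
  rcases h with h | h
  · have h1 : (z : ℤ) ∣ (r : ℤ) - r' := by
      apply hcop.symm.dvd_of_dvd_mul_right
      rw [e1]
      exact Dvd.intro_left _ rfl
    have h2 : (r : ℤ) - r' = 0 := by
      apply Int.eq_zero_of_abs_lt_dvd h1
      rw [abs_lt]
      constructor <;> omega
    rw [h2, zero_mul] at e1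
    have h3 : (s' : ℤ) - s = 0 := by
      rcases mul_eq_zero.1 e1.symm with h | h
      · exact h
      · exact absurd h hz'
    constructor <;> omega
  · have h1 : (y : ℤ) ∣ (s' : ℤ) - s := by
      apply hcop.dvd_of_dvd_mul_right
      rw [← e1]
      exact Dvd.intro_left _ rfl
    have h2 : (s' : ℤ) - s = 0 := by
      apply Int.eq_zero_of_abs_lt_dvd h1
      rw [abs_lt]
      constructor <;> omega
    rw [h2, zero_mul] at e1
    have h3 : (r : ℤ) - r' = 0 := by
      rcases mul_eq_zero.1 e1 with h | h
      · exact h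
      · exact absurd h hy'
    constructor <;> omega

lemma sum_reflect_aux (m : ℕ) : (∑ h ∈ Finset.range m, (m - h)) * 2 = m * (m + 1) := by
  induction m with
  | zero => simp
  | succ m ih =>
    rw [Finset.sum_range_succ']
    simp only [Nat.add_sub_add_right, Nat.sub_zero]
    rw [add_mul, ih]
    ring

lemma sum_fin_aux (m : ℕ) : (∑ h : Fin m, (h : ℕ)) * 2 = m * (m - 1) := by
  rw [Fin.sum_univ_eq_sum_range (fun i => i) m, Finset.sum_range_id_mul_two]

lemma pow256_aux (s : ℕ) : 256 * (s + 1) ^ 2 ≤ 256 ^ (s + 1) := by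
  induction s with
  | zero => norm_num
  | succ s ih =>
    rw [pow_succ 256 (s + 1)]
    generalize 256 ^ (s + 1) = q at ih ⊢
    have : 256 * (s + 1 + 1) ^ 2 ≤ 256 * (s + 1) ^ 2 * 256 := by
      have h0 : (s + 1 + 1) ^ 2 ≤ (2 * (s + 1)) ^ 2 := Nat.pow_le_pow_left (by omega) 2
      rw [mul_pow] at h0
      omega
    exact this.trans (Nat.mul_le_mul_right _ ih)

lemma final_ineq_aux (m t Q : ℕ)
    (f2 : (2 * m + 3) * (128 * t * (2 * m + 3) + 1) ≤
      16 * t * (2 * (m + 2)) + (Q + 34 * t * (2 * (m + 2) * (2 * m + 3))))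
    (f3 : Q ≤ (m + 1) * (2 * (m + 2) * (128 * t))) : False := by
  have h1 := Nat.zero_le (t * m)
  have h2 := Nat.zero_le (t * m ^ 2)
  ring_nf at f2 f3 h1 h2
  omega

lemma two_log (P G a b : ℤ) (y z α β μ : ℕ) (hP : 2 ≤ P) (hα : 0 < α) (hβ : 0 < β)
    (hμ : 2 ≤ μ) (hG : P ∣ G - 1)
    (ha : P ^ (256 * α * β * μ ^ 2) ∣ a - G ^ y) (hb : P ^ (256 * α * β * μ ^ 2) ∣ b - G ^ z)
    (ha2 : 2 ≤ |a|) (haP : |a| ≤ P ^ α) (hb0 : b ≠ 0) (hbP : |b| ≤ P ^ β)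
    (hyz : Nat.Coprime y z) (hy : 0 < y) (hz : 0 < z)
    (hd : 16 * β * μ ≤ z ∨ 16 * α * μ ≤ y)
    (hX : (((16 * β * μ + 2 * μ) * y + 16 * α * μ * z : ℕ) : ℤ) ≤ P ^ (μ - 1)) : False := by
  obtain ⟨t, ht⟩ : ∃ t, t = α * β * μ := ⟨_, rfl⟩
  obtain ⟨K, hK⟩ : ∃ K, K = 128 * t := ⟨_, rfl⟩
  obtain ⟨L, hL⟩ : ∃ L, L = 2 * μ := ⟨_, rfl⟩
  have ht0 : 0 < t := by rw [ht]; positivity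
  have hN : K * L = 256 * α * β * μ ^ 2 := by rw [hK, hL, ht]; ring
  have hK0 : 0 < K := by omega
  have hL0 : 0 < L := by omega
  obtain ⟨X, hXd⟩ : ∃ X, X = (16 * β * μ + L) * y + 16 * α * μ * z := ⟨_, rfl⟩
  obtain ⟨h, hh⟩ : ∃ h, h = (16 * β * μ + L) * α + 16 * α * μ * β := ⟨_, rfl⟩
  have hXP : (X : ℤ) ≤ P ^ (μ - 1) := by rw [hXd, hL]; exact hX
  have hH : |a| ^ (16 * β * μ + L) * |b| ^ (16 * α * μ) ≤ P ^ h := by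
    have hPh : P ^ h = (P ^ α) ^ (16 * β * μ + L) * (P ^ β) ^ (16 * α * μ) := by
      rw [← pow_mul, ← pow_mul, ← pow_add, hh]
      ring_nf
    rw [hPh]
    apply mul_le_mul
    · exact pow_le_pow_left₀ (abs_nonneg _) haP _
    · exact pow_le_pow_left₀ (abs_nonneg _) hbP _
    · positivity
    · positivity
  have main := interp_bound P G a b y z K L (16 * β * μ) (16 * α * μ) (256 * α * β * μ ^ 2) X
    (P ^ h) hG ha hb ha2 hb0 (by
      calc (K - 1) * L < K * L := Nat.mul_lt_mul_of_pos_right (by omega) hL0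
        _ = _ := by rw [hN]; ring) (inj_points_aux _ _ _ _ hyz hy hz hd) (by omega) (by omega) hH
  have hP1 : (1 : ℤ) ≤ P := by linarith
  have hP0 : (0 : ℤ) ≤ P := by linarith
  have hT := sum_reflect_aux (K * L - K)
  obtain ⟨T, hTd⟩ : ∃ T, T = ∑ h ∈ Finset.range (K * L - K), (K * L - K - h) := ⟨_, rfl⟩
  rw [← hTd] at hT main
  have hfac : ((K * L).factorial : ℤ) ≤ P ^ (8 * t * (K * L)) := by
    have h1 : (K * L).factorial ≤ (K * L) ^ (K * L) := Nat.factorial_le_pow _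
    have h2 : K * L ≤ 2 ^ (8 * t) := by
      have h3 : K * L ≤ 256 * t ^ 2 := by
        rw [hN, ht]
        have h5 : α * β ≤ (α * β) ^ 2 := Nat.le_self_pow (by norm_num) _
        calc 256 * α * β * μ ^ 2 = 256 * (α * β) * μ ^ 2 := by ring
          _ ≤ 256 * (α * β) ^ 2 * μ ^ 2 := by gcongr
          _ = _ := by ring
      obtain ⟨t', rfl⟩ : ∃ t', t = t' + 1 := ⟨t - 1, by omega⟩
      calc K * L ≤ _ := h3
        _ ≤ _ := pow256_aux t'
        _ = _ := by rw [pow_mul]; norm_num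
    have h3 : ((K * L : ℕ) : ℤ) ≤ P ^ (8 * t) := by
      calc ((K * L : ℕ) : ℤ) ≤ ((2 ^ (8 * t) : ℕ) : ℤ) := by exact_mod_cast h2
        _ = (2 : ℤ) ^ (8 * t) := by push_cast; rfl
        _ ≤ P ^ (8 * t) := pow_le_pow_left₀ (by norm_num) hP _
    calc ((K * L).factorial : ℤ) ≤ (((K * L) ^ (K * L) : ℕ) : ℤ) := by exact_mod_cast h1
      _ = ((K * L : ℕ) : ℤ) ^ (K * L) := by push_cast; rfl
      _ ≤ (P ^ (8 * t)) ^ (K * L) := pow_le_pow_left₀ (by positivity) h3 _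
      _ = _ := by rw [← pow_mul]
  obtain ⟨s1, hs1⟩ : ∃ s, s = ∑ k : Fin K, (k : ℕ) := ⟨_, rfl⟩
  obtain ⟨s2, hs2⟩ : ∃ s, s = ∑ k : Fin L, (k : ℕ) := ⟨_, rfl⟩
  have hs1' := sum_fin_aux K
  have hs2' := sum_fin_aux L
  rw [← hs1] at hs1'
  rw [← hs2] at hs2'
  have hprod : ∏ q : Fin K × Fin L, ((X : ℤ) ^ (q.1 : ℕ) * (P ^ h) ^ (q.2 : ℕ)) ≤
      P ^ ((μ - 1) * (L * s1) + h * (K * s2)) := by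
    calc _ ≤ ∏ q : Fin K × Fin L, P ^ ((μ - 1) * (q.1 : ℕ) + h * (q.2 : ℕ)) := by
          apply Finset.prod_le_prod
          · intros; positivity
          · intro q _
            rw [pow_add, pow_mul, pow_mul]
            apply mul_le_mul_of_nonneg_right _ (by positivity)
            exact pow_le_pow_left₀ (by positivity) hXP _
      _ = _ := by
          rw [Finset.prod_pow_eq_pow_sum, Fintype.sum_prod_type]
          congr 1
          simp only [Finset.sum_add_distrib, ← Finset.mul_sum, Finset.sum_const, Finset.card_univ,
            Fintype.card_fin, smul_eq_mul, ← hs1, ← hs2]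
  have hle : P ^ T ≤ P ^ (8 * t * (K * L) + ((μ - 1) * (L * s1) + h * (K * s2))) := by
    refine main.trans ?_
    rw [pow_add]
    apply mul_le_mul hfac hprod _ (by positivity)
    apply Finset.prod_nonneg
    intros
    positivity
  have hexp : T ≤ 8 * t * (K * L) + ((μ - 1) * (L * s1) + h * (K * s2)) :=
    (pow_le_pow_iff_right₀ (by linarith)).1 hle
  have hh' : h ≤ 34 * t := by
    rw [hh, hL, ht]
    have h1 : α * μ ≤ α * μ * β := Nat.le_mul_of_pos_right _ hβ
    have h2 : (16 * β * μ + 2 * μ) * α + 16 * α * μ * β = 32 * (α * μ * β) + 2 * (α * μ) := by ring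
    have h3 : α * β * μ = α * μ * β := by ring
    rw [h2, h3]
    omega
  obtain ⟨m, rfl⟩ : ∃ m, μ = m + 2 := ⟨μ - 2, by omega⟩
  obtain ⟨k, rfl⟩ : ∃ k, K = k + 1 := ⟨K - 1, by omega⟩
  have hsub : (k + 1) * L - (k + 1) = (k + 1) * (2 * m + 3) := by
    rw [hL]
    apply Nat.sub_eq_of_eq_add
    ring
  rw [hsub] at hT
  simp only [Nat.add_sub_cancel] at hs1'
  have hL1 : L - 1 = 2 * m + 3 := by omega
  rw [hL1] at hs2'
  rw [show m + 2 - 1 = m + 1 by omega] at hexp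
  -- combine
  have f1 : (k + 1) * (2 * m + 3) * ((k + 1) * (2 * m + 3) + 1) ≤
      16 * t * ((k + 1) * L) + ((m + 1) * (L * ((k + 1) * k)) +
        34 * t * ((k + 1) * (L * (2 * m + 3)))) := by
    calc _ = T * 2 := hT.symm
      _ ≤ (8 * t * ((k + 1) * L) + ((m + 1) * (L * s1) + h * ((k + 1) * s2))) * 2 :=
          Nat.mul_le_mul_right _ hexp
      _ = 16 * t * ((k + 1) * L) + ((m + 1) * (L * (s1 * 2)) + h * ((k + 1) * (s2 * 2))) := by
          ring
      _ = 16 * t * ((k + 1) * L) + ((m + 1) * (L * ((k + 1) * k)) +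
          h * ((k + 1) * (L * (2 * m + 3)))) := by rw [hs1', hs2']
      _ ≤ _ := by gcongr
  have f2 : (2 * m + 3) * ((k + 1) * (2 * m + 3) + 1) ≤
      16 * t * L + ((m + 1) * (L * k) + 34 * t * (L * (2 * m + 3))) := by
    apply Nat.le_of_mul_le_mul_left _ (Nat.succ_pos k)
    calc _ = (k + 1) * (2 * m + 3) * ((k + 1) * (2 * m + 3) + 1) := by
          rw [Nat.succ_eq_add_one]; ring
      _ ≤ _ := f1
      _ = _ := by rw [Nat.succ_eq_add_one]; ring
  have f3 : (m + 1) * (L * k) ≤ (m + 1) * (L * (128 * t)) := by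
    gcongr
    omega
  rw [hK, hL] at f2
  rw [hL] at f3
  exact final_ineq_aux m t _ f2 f3

lemma exists_root_aux (m P a b : ℤ) (y z : ℕ) (hPm : P ∣ m) (ha : P ∣ a - 1) (hb : P ∣ b - 1)
    (hbm : IsCoprime b m) (hyz : Nat.Coprime y z) (hy : 0 < y) (hz : 0 < z)
    (h : m ∣ a ^ z - b ^ y) :
    ∃ G : ℤ, P ∣ G - 1 ∧ m ∣ a - G ^ y ∧ m ∣ b - G ^ z := by
  obtain ⟨u, v, huv⟩ : ∃ u v : ℕ, u * y = 1 + v * z := by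
    rcases Nat.lt_or_ge 1 z with hz1 | hz1
    · obtain ⟨u, hu⟩ := Nat.exists_mul_mod_eq_one_of_coprime hyz hz1
      refine ⟨u, y * u / z, ?_⟩
      have := Nat.mod_add_div (y * u) z
      rw [hu.2] at this
      rw [mul_comm u, mul_comm _ z]
      exact this.symm
    · have : z = 1 := by omega
      subst this
      exact ⟨1, y - 1, by omega⟩
  obtain ⟨p, q, hpq⟩ := hbm
  have hp : p * b ≡ 1 [ZMOD m] := by
    apply Int.ModEq.symm
    apply (Int.modEq_iff_dvd).2
    exact ⟨-q, by linear_combination hpq⟩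
  have haz : a ^ z ≡ b ^ y [ZMOD m] := ((Int.modEq_iff_dvd).2 h).symm
  have ha1 : a ≡ 1 [ZMOD P] := ((Int.modEq_iff_dvd).2 ha).symm
  have hb1 : b ≡ 1 [ZMOD P] := ((Int.modEq_iff_dvd).2 hb).symm
  have hp1 : p ≡ 1 [ZMOD P] := by
    have h1 : p * b ≡ 1 [ZMOD P] := hp.of_dvd hPm
    have h2 : p * b ≡ p * 1 [ZMOD P] := hb1.mul_left p
    rw [mul_one] at h2
    exact h2.symm.trans h1
  refine ⟨a ^ u * p ^ v, ?_, ?_, ?_⟩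
  · apply (Int.modEq_iff_dvd).1
    apply Int.ModEq.symm
    simpa using (ha1.pow u).mul (hp1.pow v)
  · apply (Int.modEq_iff_dvd).1
    calc (a ^ u * p ^ v) ^ y = a * ((a ^ z) ^ v * (p ^ y) ^ v) := by
          rw [mul_pow, ← pow_mul, huv, pow_add, pow_one, ← pow_mul, ← pow_mul, ← pow_mul,
            mul_comm v z, mul_comm v y, mul_assoc]
      _ ≡ a * ((b ^ y) ^ v * (p ^ y) ^ v) [ZMOD m] := by gcongr
      _ = a * ((p * b) ^ y) ^ v := by rw [mul_pow p b, mul_pow]; ring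
      _ ≡ a * ((1 : ℤ) ^ y) ^ v [ZMOD m] := by gcongr
      _ = a := by simp
  · apply (Int.modEq_iff_dvd).1
    calc (a ^ u * p ^ v) ^ z = (a ^ z) ^ u * p ^ (v * z) := by
          rw [mul_pow, ← pow_mul, ← pow_mul, ← pow_mul, mul_comm u z]
      _ ≡ (b ^ y) ^ u * p ^ (v * z) [ZMOD m] := by gcongr
      _ = b * (p * b) ^ (v * z) := by
          rw [← pow_mul, mul_comm y u, huv, pow_add, pow_one, mul_pow]; ring
      _ ≡ b * 1 ^ (v * z) [ZMOD m] := by gcongr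
      _ = b := by simp

/-! ### Elementary consequences of the equation -/

lemma exps_le_aux (n x y z w : ℕ) (hn : 10 ≤ n)
    (h : (n - 1) ^ x + n ^ y + (n + 1) ^ z = (n + 2) ^ w) :
    x ≤ 2 * w ∧ y ≤ 2 * w ∧ z ≤ 2 * w := by
  obtain ⟨m, rfl⟩ : ∃ m, n = m + 1 := ⟨n - 1, by omega⟩
  rw [Nat.add_sub_cancel] at h
  have key : (m + 1 + 2) ^ w ≤ m ^ (2 * w) := by
    rw [pow_mul]
    apply Nat.pow_le_pow_left
    nlinarith
  have hx : m ^ x ≤ m ^ (2 * w) := by omega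
  have hy : (m + 1) ^ y ≤ (m + 1) ^ (2 * w) := by
    have := Nat.pow_le_pow_left (Nat.le_succ m) (2 * w)
    rw [Nat.succ_eq_add_one] at this
    omega
  have hz : (m + 1 + 1) ^ z ≤ (m + 1 + 1) ^ (2 * w) := by
    have := Nat.pow_le_pow_left (show m ≤ m + 1 + 1 by omega) (2 * w)
    omega
  exact ⟨(Nat.pow_le_pow_iff_right (by omega)).1 hx, (Nat.pow_le_pow_iff_right (by omega)).1 hy,
    (Nat.pow_le_pow_iff_right (by omega)).1 hz⟩

lemma bern1_aux (n w : ℕ) (hn : 16 ≤ n) (hw : 8 * w ≤ n) :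
    3 * (n + 2) ^ w ≤ 4 * n ^ w := by
  have hn' : (16 : ℝ) ≤ n := by exact_mod_cast hn
  have hw' : (8 : ℝ) * w ≤ n := by exact_mod_cast hw
  have hpos : (0 : ℝ) < (n : ℝ) + 2 := by linarith
  have h1 : (1 : ℝ) + w * (-(2 / ((n : ℝ) + 2))) ≤ (1 + -(2 / ((n : ℝ) + 2))) ^ w := by
    apply one_add_mul_le_pow
    have : 2 / ((n : ℝ) + 2) ≤ 1 := by rw [div_le_one hpos]; linarith
    linarith
  have h2 : (1 + -(2 / ((n : ℝ) + 2))) = n / (n + 2) := by field_simp; ring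
  rw [h2, div_pow] at h1
  have h3 : (3 : ℝ) / 4 ≤ 1 + w * (-(2 / ((n : ℝ) + 2))) := by
    have : (w : ℝ) * (2 / ((n : ℝ) + 2)) ≤ 1 / 4 := by
      rw [mul_div_assoc', div_le_iff₀ hpos]
      linarith
    linarith
  have h4 := h3.trans h1
  rw [le_div_iff₀ (by positivity)] at h4
  have h5 : (3 : ℝ) * (n + 2) ^ w ≤ 4 * n ^ w := by linarith
  exact_mod_cast h5

lemma bern2_aux (n w : ℕ) (hn : 16 ≤ n) (hw : 8 * w ≤ n) :
    7 * n ^ w ≤ 8 * (n - 1) ^ w := by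
  obtain ⟨m, rfl⟩ : ∃ m, n = m + 1 := ⟨n - 1, by omega⟩
  rw [Nat.add_sub_cancel]
  have hn' : (16 : ℝ) ≤ m + 1 := by exact_mod_cast hn
  have hw' : (8 : ℝ) * w ≤ m + 1 := by exact_mod_cast hw
  have hpos : (0 : ℝ) < (m : ℝ) + 1 := by linarith
  have h1 : (1 : ℝ) + w * (-(1 / ((m : ℝ) + 1))) ≤ (1 + -(1 / ((m : ℝ) + 1))) ^ w := by
    apply one_add_mul_le_pow
    have : 1 / ((m : ℝ) + 1) ≤ 1 := by rw [div_le_one hpos]; linarith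
    linarith
  have h2 : (1 + -(1 / ((m : ℝ) + 1))) = m / (m + 1) := by field_simp; ring
  rw [h2, div_pow] at h1
  have h3 : (7 : ℝ) / 8 ≤ 1 + w * (-(1 / ((m : ℝ) + 1))) := by
    have : (w : ℝ) * (1 / ((m : ℝ) + 1)) ≤ 1 / 8 := by
      rw [mul_div_assoc', div_le_iff₀ hpos]
      linarith
    linarith
  have h4 := h3.trans h1
  rw [le_div_iff₀ (by positivity)] at h4
  have h5 : (7 : ℝ) * (m + 1) ^ w ≤ 8 * m ^ w := by linarith
  exact_mod_cast h5

lemma w_large_aux (n x y z w : ℕ) (hn : 16 ≤ n) (hxp : 0 < x) (hyp : 0 < y) (hw0 : 0 < w)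
    (h : (n - 1) ^ x + n ^ y + (n + 1) ^ z = (n + 2) ^ w) : n ≤ 8 * w := by
  by_contra hcon
  push Not at hcon
  have b1 := bern1_aux n w hn hcon.le
  have b2 := bern2_aux n w hn hcon.le
  have hpos : 0 < n ^ w := by positivity
  have hx0 : 0 < (n - 1) ^ x := Nat.pow_pos (by omega)
  have hy0 : 0 < n ^ y := by positivity
  have hz0 : 0 < (n + 1) ^ z := by positivity
  have hzw : n ^ w ≤ (n + 1) ^ w := Nat.pow_le_pow_left (by omega) _
  have hx : x ≤ w := by
    by_contra hc
    have h1 : (n - 1) ^ (w + 1) ≤ (n - 1) ^ x := Nat.pow_le_pow_right (by omega) (by omega)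
    rw [pow_succ] at h1
    have h2 : (n - 1) ^ w * 2 ≤ (n - 1) ^ w * (n - 1) := Nat.mul_le_mul_left _ (by omega)
    omega
  have hy : y ≤ w := by
    by_contra hc
    have h1 : n ^ (w + 1) ≤ n ^ y := Nat.pow_le_pow_right (by omega) (by omega)
    rw [pow_succ] at h1
    have h2 : n ^ w * 2 ≤ n ^ w * n := Nat.mul_le_mul_left _ (by omega)
    omega
  have hz : z ≤ w := by
    by_contra hc
    have h1 : (n + 1) ^ (w + 1) ≤ (n + 1) ^ z := Nat.pow_le_pow_right (by omega) (by omega)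
    rw [pow_succ] at h1
    have h2 : (n + 1) ^ w * 2 ≤ (n + 1) ^ w * (n + 1) := Nat.mul_le_mul_left _ (by omega)
    omega
  have hxy : ¬ (x = w ∧ y = w) := by
    rintro ⟨rfl, rfl⟩
    omega
  have hxz : ¬ (x = w ∧ z = w) := by
    rintro ⟨rfl, rfl⟩
    omega
  have hyz : ¬ (y = w ∧ z = w) := by
    rintro ⟨rfl, rfl⟩
    omega
  rcases Nat.lt_or_ge w 2 with hw2 | hw2
  · have : w = 1 := by omega
    subst this
    exact hxy ⟨by omega, by omega⟩
  obtain ⟨v, rfl⟩ : ∃ v, w = v + 2 := ⟨w - 2, by omega⟩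
  have c1 : (n + 1) ^ v ≤ (n + 2) ^ v := Nat.pow_le_pow_left (by omega) _
  have c0 : 0 < (n + 1) ^ v := by positivity
  have c2 : (n + 1) ^ (v + 2) + 2 * (n + 1) ^ (v + 1) < (n + 2) ^ (v + 2) := by
    calc (n + 1) ^ (v + 2) + 2 * (n + 1) ^ (v + 1) = (n ^ 2 + 4 * n + 3) * (n + 1) ^ v := by ring
      _ < (n ^ 2 + 4 * n + 4) * (n + 1) ^ v := Nat.mul_lt_mul_of_pos_right (by omega) c0
      _ ≤ (n ^ 2 + 4 * n + 4) * (n + 2) ^ v := Nat.mul_le_mul_left _ c1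
      _ = _ := by ring
  have up : ∀ a u v : ℕ, a ≤ n + 1 → u ≤ v → a ^ u ≤ (n + 1) ^ v := fun a u v ha hu =>
    (Nat.pow_le_pow_left ha u).trans (Nat.pow_le_pow_right (by omega) hu)
  by_cases hx1 : x = v + 2
  · have d1 := up (n - 1) x (v + 2) (by omega) (by omega)
    have d2 := up n y (v + 1) (by omega) (by omega)
    have d3 := up (n + 1) z (v + 1) (by omega) (by omega)
    omega
  have d1 := up (n - 1) x (v + 1) (by omega) (by omega)
  by_cases hy1 : y = v + 2
  · have d2 := up n y (v + 2) (by omega) (by omega)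
    have d3 := up (n + 1) z (v + 1) (by omega) (by omega)
    omega
  have d2 := up n y (v + 1) (by omega) (by omega)
  have d3 := up (n + 1) z (v + 2) (by omega) (by omega)
  omega

lemma z_odd_aux (e x y z w : ℕ) (hx : 0 < x) (hw : 0 < w)
    (h : (4 ^ e - 1) ^ x + (4 ^ e) ^ y + (4 ^ e + 1) ^ z = (4 ^ e + 2) ^ w) : Odd z := by
  have h1 : 4 ^ e ≡ 1 [MOD 3] := by
    simpa using (show 4 ≡ 1 [MOD 3] by decide).pow e
  generalize 4 ^ e = n at h h1
  have hn : n % 3 = 1 := h1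
  by_contra hz
  rw [Nat.not_odd_iff_even] at hz
  obtain ⟨t, rfl⟩ := hz
  have a1 : (n - 1) ^ x ≡ 0 [MOD 3] := by
    have : n - 1 ≡ 0 [MOD 3] := by unfold Nat.ModEq; omega
    simpa [hx.ne'] using this.pow x
  have a2 : n ^ y ≡ 1 [MOD 3] := by simpa using h1.pow y
  have a3 : (n + 1) ^ (t + t) ≡ 1 [MOD 3] := by
    rw [← two_mul, pow_mul]
    have : (n + 1) ^ 2 ≡ 1 [MOD 3] := by
      have : n + 1 ≡ 2 [MOD 3] := by unfold Nat.ModEq; omega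
      exact this.pow 2
    simpa using this.pow t
  have a4 : (n + 2) ^ w ≡ 0 [MOD 3] := by
    have : n + 2 ≡ 0 [MOD 3] := by unfold Nat.ModEq; omega
    simpa [hw.ne'] using this.pow w
  have a5 := (a1.add a2).add a3
  rw [h] at a5
  have := a4.symm.trans a5
  revert this
  decide

lemma xy_aux (e x y z w : ℕ) (he : 2 ≤ e) (hz : 0 < z)
    (h : (4 ^ e - 1) ^ x + (4 ^ e) ^ y + (4 ^ e + 1) ^ z = (4 ^ e + 2) ^ w) :
    Odd y ∧ ∃ q, Odd q ∧ x = 2 * e * q + 1 := by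
  have hn16 : 16 ≤ 4 ^ e := by
    calc 16 = 4 ^ 2 := by norm_num
      _ ≤ 4 ^ e := Nat.pow_le_pow_right (by norm_num) he
  have h2e : (4 : ℤ) ^ e = 2 ^ (2 * e) := by rw [pow_mul]; norm_num
  have hZ : ((4 : ℤ) ^ e - 1) ^ x + (4 ^ e) ^ y + (4 ^ e + 1) ^ z = (4 ^ e + 2) ^ w := by
    have := congrArg (Nat.cast : ℕ → ℤ) h
    push_cast [Nat.cast_sub (show 1 ≤ 4 ^ e by omega)] at this
    exact this
  obtain ⟨N, hN⟩ : ∃ N : ℤ, N = 4 ^ e := ⟨_, rfl⟩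
  have hN16 : 16 ≤ N := by rw [hN]; exact_mod_cast hn16
  rw [← hN] at hZ h2e
  have m1 : N ≡ -1 [ZMOD N + 1] := by
    apply (Int.modEq_iff_dvd).2
    exact ⟨-1, by ring⟩
  have b1 : (N - 1) ^ x ≡ (-2) ^ x [ZMOD N + 1] := by
    apply Int.ModEq.pow
    simpa using m1.sub_right 1
  have b2 : N ^ y ≡ (-1) ^ y [ZMOD N + 1] := m1.pow y
  have b3 : (N + 1) ^ z ≡ 0 [ZMOD N + 1] := by
    apply (Int.modEq_zero_iff_dvd).2
    exact dvd_pow_self _ hz.ne'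
  have b4 : (N + 2) ^ w ≡ 1 [ZMOD N + 1] := by
    have : N + 2 ≡ 1 [ZMOD N + 1] := by
      apply (Int.modEq_iff_dvd).2
      exact ⟨-1, by ring⟩
    simpa using this.pow w
  have b5 : (-2) ^ x + (-1) ^ y ≡ 1 [ZMOD N + 1] := by
    have := ((b1.add b2).add b3).symm
    rw [hZ, add_zero] at this
    exact this.trans b4
  have hyodd : Odd y := by
    by_contra hy
    rw [Nat.not_odd_iff_even] at hy
    rw [hy.neg_one_pow] at b5
    have : (N + 1) ∣ (-2) ^ x := by
      have := (Int.modEq_iff_dvd).1 b5.symm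
      simpa using this
    have hc : IsCoprime (N + 1) ((-2) ^ x) := by
      apply IsCoprime.pow_right
      rw [h2e]
      refine ⟨1, 2 ^ (2 * e - 1), ?_⟩
      have : (2 : ℤ) ^ (2 * e) = 2 ^ (2 * e - 1) * 2 := by
        rw [← pow_succ]; congr 1; omega
      rw [this]; ring
    have := hc.isUnit_of_dvd' (dvd_refl _) this
    rw [Int.isUnit_iff] at this
    omega
  refine ⟨hyodd, ?_⟩
  rw [hyodd.neg_one_pow] at b5
  have b6 : (-2) ^ x ≡ 2 [ZMOD N + 1] := by simpa using b5.add_right 1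
  refine ⟨x / (2 * e), ?_⟩
  obtain ⟨q, hq⟩ : ∃ q, q = x / (2 * e) := ⟨_, rfl⟩
  obtain ⟨r, hr⟩ : ∃ r, r = x % (2 * e) := ⟨_, rfl⟩
  have hx : x = 2 * e * q + r := by rw [hq, hr]; exact (Nat.div_add_mod _ _).symm
  have hr2 : r < 2 * e := by rw [hr]; exact Nat.mod_lt _ (by omega)
  rw [← hq]
  clear hq hr
  have b7 : (-1) ^ (r + q) * 2 ^ r ≡ 2 [ZMOD N + 1] := by
    have : (-2 : ℤ) ^ x = N ^ q * ((-1) ^ r * 2 ^ r) := by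
      rw [hx, pow_add, pow_mul, (even_two_mul e).neg_pow, ← h2e, ← mul_pow]
      norm_num
    rw [this] at b6
    have h2 : N ^ q * ((-1) ^ r * 2 ^ r) ≡ (-1) ^ q * ((-1) ^ r * 2 ^ r) [ZMOD N + 1] := by
      gcongr
    have := h2.symm.trans b6
    rw [pow_add]
    convert this using 1
    ring
  have hrN : (2 : ℤ) ^ r * 2 ≤ N := by
    rw [h2e, ← pow_succ]
    exact pow_le_pow_right₀ (by norm_num) (by omega)
  have hr1 : (1 : ℤ) ≤ 2 ^ r := one_le_pow₀ (by norm_num)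
  have hd := (Int.modEq_iff_dvd).1 b7.symm
  rcases Nat.even_or_odd (r + q) with ho | ho
  · rw [ho.neg_one_pow, one_mul] at hd
    have h0 : (2 : ℤ) ^ r - 2 = 0 := by
      apply Int.eq_zero_of_abs_lt_dvd hd
      rw [abs_lt]; constructor <;> linarith
    have hr : r = 1 := by
      have : (2 : ℕ) ^ r = 2 ^ 1 := by
        have : (2 : ℤ) ^ r = 2 := by linarith
        exact_mod_cast this
      exact Nat.pow_right_injective (le_refl 2) this
    subst hr
    refine ⟨?_, hx⟩
    obtain ⟨t, ht⟩ := ho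
    exact ⟨t - 1, by omega⟩
  · rw [ho.neg_one_pow] at hd
    exfalso
    have h0 : (-1) * (2 : ℤ) ^ r - 2 = 0 := by
      apply Int.eq_zero_of_abs_lt_dvd hd
      rw [abs_lt]; constructor <;> linarith
    linarith

/-! ### Applications of the two-logarithm estimate -/

lemma core2 (n z β μ M : ℕ) (hn : 16 ≤ n) (hμ : 2 ≤ μ) (hβ : 0 < β) (hz : 0 < z)
    (hM0 : 0 < M) (hM : M ≤ n ^ β) (hdvd : n ^ (512 * β * μ ^ 2) ∣ (n + 1) ^ z + M)
    (hX : (16 * β * μ + 2 * μ) + 32 * μ * z ≤ n ^ (μ - 1)) : False := by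
  by_cases hzb : 16 * β * μ ≤ z
  · apply two_log (n : ℤ) ((n : ℤ) + 1) ((n : ℤ) + 1) (-(M : ℤ)) 1 z 2 β μ
    · exact_mod_cast (by omega : 2 ≤ n)
    · norm_num
    · exact hβ
    · exact hμ
    · simp
    · simp
    · have h1 : ((n ^ (512 * β * μ ^ 2) : ℕ) : ℤ) ∣ (((n + 1) ^ z + M : ℕ) : ℤ) :=
        Int.natCast_dvd_natCast.2 hdvd
      push_cast at h1
      have h2 : -(M : ℤ) - ((n : ℤ) + 1) ^ z = -(((n : ℤ) + 1) ^ z + M) := by ring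
      rw [h2]
      exact (dvd_neg).2 h1
    · have : (0 : ℤ) ≤ (n : ℤ) + 1 := by positivity
      rw [abs_of_nonneg this]
      have : (16 : ℤ) ≤ n := by exact_mod_cast hn
      linarith
    · have : (0 : ℤ) ≤ (n : ℤ) + 1 := by positivity
      rw [abs_of_nonneg this]
      have : (16 : ℤ) ≤ n := by exact_mod_cast hn
      nlinarith
    · have : (M : ℤ) ≠ 0 := by positivity
      exact neg_ne_zero.2 this
    · rw [abs_neg, Nat.abs_cast]
      exact_mod_cast hM
    · exact Nat.coprime_one_left z
    · norm_num
    · exact hz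
    · exact Or.inl hzb
    · have h1 : ((16 * β * μ + 2 * μ) * 1 + 16 * 2 * μ * z : ℕ) ≤ n ^ (μ - 1) := by
        have : 16 * 2 * μ * z = 32 * μ * z := by ring
        rw [mul_one, this]
        exact hX
      exact_mod_cast h1
  · push Not at hzb
    have h1 := Nat.le_of_dvd (by positivity) hdvd
    have h2 : (n + 1) ^ z ≤ n ^ (32 * β * μ) := by
      calc (n + 1) ^ z ≤ (n ^ 2) ^ z := Nat.pow_le_pow_left (by nlinarith) _
        _ = n ^ (2 * z) := by rw [pow_mul]
        _ ≤ n ^ (32 * β * μ) := Nat.pow_le_pow_right (by omega) (by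
            have : 32 * β * μ = 2 * (16 * β * μ) := by ring
            omega)
    have h3 : M ≤ n ^ (32 * β * μ) := hM.trans (Nat.pow_le_pow_right (by omega) (by nlinarith))
    have h4 : n ^ (32 * β * μ + 1) ≤ n ^ (512 * β * μ ^ 2) := by
      apply Nat.pow_le_pow_right (by omega)
      have : 0 < β * μ := by positivity
      nlinarith
    rw [pow_succ] at h4
    have h5 : 0 < n ^ (32 * β * μ) := by positivity
    nlinarith

lemma core3 (e k y z m : ℕ) (he : 0 < e) (hk : 2 ≤ k) (hy : 0 < y) (hz : Odd z)
    (hdvd : 3 ^ m ∣ (4 ^ e) ^ y + (4 ^ e + 1) ^ z)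
    (hX : 34 * k * (e * y) + 32 * e * k * z ≤ 3 ^ (k - 1)) : m < 1024 * e * k ^ 2 + k := by
  by_contra hcon
  push Not at hcon
  have hz0 : 0 < z := hz.pos
  have hey : 0 < e * y := by positivity
  obtain ⟨d, hd⟩ : ∃ d, d = Nat.gcd (e * y) z := ⟨_, rfl⟩
  have hd0 : 0 < d := by rw [hd]; exact Nat.gcd_pos_of_pos_right _ hz0
  obtain ⟨Y, hY⟩ : d ∣ e * y := hd ▸ Nat.gcd_dvd_left _ _
  obtain ⟨Z, hZ⟩ : d ∣ z := hd ▸ Nat.gcd_dvd_right _ _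
  have hcop : Nat.Coprime Y Z := by
    have h1 : d * Nat.gcd Y Z = d * 1 := by
      rw [← Nat.gcd_mul_left, ← hY, ← hZ, mul_one, hd]
    exact Nat.eq_of_mul_eq_mul_left hd0 h1
  have hY0 : 0 < Y := Nat.pos_of_ne_zero (by rintro rfl; simp at hY; omega)
  have hZ0 : 0 < Z := Nat.pos_of_ne_zero (by rintro rfl; simp at hZ; omega)
  have hYle : Y ≤ e * y := by rw [hY]; exact Nat.le_mul_of_pos_left _ hd0
  have hZle : Z ≤ z := by rw [hZ]; exact Nat.le_mul_of_pos_left _ hd0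
  have hdle : d ≤ z := by
    calc d ≤ d * Z := Nat.le_mul_of_pos_right _ hZ0
      _ = z := hZ.symm
  have hz3 : z < 3 ^ k := by
    have h1 : 1 * z ≤ 32 * e * k * z := Nat.mul_le_mul_right _ (by
      have : 0 < e * k := by positivity
      nlinarith)
    have h2 : 3 ^ (k - 1) < 3 ^ k := Nat.pow_lt_pow_right (by norm_num) (by omega)
    omega
  obtain ⟨a, ha⟩ : ∃ a : ℤ, a = -(4 ^ e + 1) := ⟨_, rfl⟩
  have ha3 : (3 : ℤ) ∣ a - 1 := by
    have h1 : (3 : ℤ) ∣ 4 ^ e - 1 := by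
      simpa using sub_dvd_pow_sub_pow (4 : ℤ) 1 e
    rw [ha]
    omega
  have h4e : (4 : ℤ) ≤ 4 ^ e := by
    simpa using pow_le_pow_right₀ (show (1 : ℤ) ≤ 4 by norm_num) (show 1 ≤ e from he)
  have h43 : (4 : ℤ) ^ e + 1 ≤ 3 ^ (2 * e) := by
    have h1 : (4 : ℤ) ^ e < 9 ^ e := pow_lt_pow_left₀ (by norm_num) (by norm_num) he.ne'
    have h2 : (3 : ℤ) ^ (2 * e) = 9 ^ e := by rw [pow_mul]; norm_num
    rw [h2]
    linarith
  have haabs : |a| = 4 ^ e + 1 := by rw [ha, abs_neg, abs_of_nonneg (by positivity)]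
  obtain ⟨N, hN⟩ : ∃ N, N = 1024 * e * k ^ 2 := ⟨_, rfl⟩
  have hpow : (3 : ℤ) ^ (N + k) ∣ (a ^ Z) ^ d - (4 ^ Y) ^ d := by
    rw [← pow_mul, ← pow_mul, mul_comm Z, mul_comm Y, ← hZ, ← hY, ha, hz.neg_pow, pow_mul]
    have h1 : ((3 ^ m : ℕ) : ℤ) ∣ (((4 ^ e) ^ y + (4 ^ e + 1) ^ z : ℕ) : ℤ) :=
      Int.natCast_dvd_natCast.2 hdvd
    push_cast at h1
    have h2 : -((4 : ℤ) ^ e + 1) ^ z - (4 ^ e) ^ y = -((4 ^ e) ^ y + (4 ^ e + 1) ^ z) := by ring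
    rw [h2]
    refine (dvd_neg).2 ((pow_dvd_pow 3 ?_).trans h1)
    omega
  have h3a : ¬ (3 : ℤ) ∣ a := by omega
  have hAB3 : (3 : ℤ) ∣ a ^ Z - 4 ^ Y := by
    have h1 : (3 : ℤ) ∣ a ^ Z - 1 := ha3.trans (by simpa using sub_dvd_pow_sub_pow a 1 Z)
    have h2 : (3 : ℤ) ∣ 4 ^ Y - 1 := by simpa using sub_dvd_pow_sub_pow (4 : ℤ) 1 Y
    have := dvd_sub h1 h2
    simpa using this
  have hNdvd : (3 : ℤ) ^ N ∣ a ^ Z - 4 ^ Y := by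
    have lte := Int.emultiplicity_pow_sub_pow Nat.prime_three (by decide) (x := a ^ Z)
      (y := 4 ^ Y) (by exact_mod_cast hAB3)
      (by
        intro h
        exact h3a (Int.prime_three.dvd_of_dvd_pow (by exact_mod_cast h))) d
    have h1 : ((N + k : ℕ) : ℕ∞) ≤ emultiplicity ((3 : ℕ) : ℤ) ((a ^ Z) ^ d - (4 ^ Y) ^ d) :=
      le_emultiplicity_of_pow_dvd (by exact_mod_cast hpow)
    rw [lte] at h1
    have h2 : emultiplicity 3 d < (k : ℕ∞) := by
      apply emultiplicity_lt_iff_not_dvd.2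
      intro h
      have := Nat.le_of_dvd hd0 h
      omega
    by_contra hc
    have h3 : emultiplicity ((3 : ℕ) : ℤ) (a ^ Z - 4 ^ Y) < (N : ℕ∞) :=
      emultiplicity_lt_iff_not_dvd.2 (by exact_mod_cast hc)
    have h4 := ENat.add_lt_add h3 h2
    push_cast at h1
    exact absurd (lt_of_le_of_lt h1 h4) (lt_irrefl _)
  by_cases hbig : 16 * 2 * k ≤ Z ∨ 16 * (2 * e) * k ≤ Y
  · obtain ⟨G, hG, hGa, hGb⟩ := exists_root_aux ((3 : ℤ) ^ N) 3 a 4 Y Z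
      (dvd_pow_self _ (by rw [hN]; positivity)) ha3 (by norm_num)
      (IsCoprime.pow_right ⟨1, -1, by norm_num⟩) hcop hY0 hZ0 hNdvd
    have hNN : 256 * (2 * e) * 2 * k ^ 2 = N := by rw [hN]; ring
    refine two_log 3 G a 4 Y Z (2 * e) 2 k (by norm_num) (by omega) (by norm_num) hk hG
      (by rw [hNN]; exact hGa) (by rw [hNN]; exact hGb) (by rw [haabs]; linarith)
      (by rw [haabs]; exact h43) (by norm_num) (by norm_num) hcop hY0 hZ0 hbig ?_
    have h1 : (16 * 2 * k + 2 * k) * Y + 16 * (2 * e) * k * Z ≤ 3 ^ (k - 1) := by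
      calc (16 * 2 * k + 2 * k) * Y + 16 * (2 * e) * k * Z = 34 * k * Y + 32 * e * k * Z := by ring
        _ ≤ 34 * k * (e * y) + 32 * e * k * z := by gcongr
        _ ≤ _ := hX
    exact_mod_cast h1
  · push Not at hbig
    obtain ⟨hZk, hYk⟩ := hbig
    have hne : a ^ Z - 4 ^ Y ≠ 0 := by
      intro h0
      have h1 : Odd (a ^ Z) := by
        apply Odd.pow
        rw [ha]
        apply Odd.neg
        apply Even.add_one
        apply Even.pow_of_ne_zero _ he.ne'
        decide
      have h2 : Even ((4 : ℤ) ^ Y) := Even.pow_of_ne_zero (by decide) hY0.ne'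
      rw [sub_eq_zero.1 h0] at h1
      exact (Int.not_even_iff_odd.2 h1) h2
    have hle := Int.le_of_dvd (abs_pos.2 hne) ((dvd_abs _ _).2 hNdvd)
    have u1 : |a ^ Z| ≤ 3 ^ (64 * e * k) := by
      rw [abs_pow, haabs]
      calc ((4 : ℤ) ^ e + 1) ^ Z ≤ (3 ^ (2 * e)) ^ Z := pow_le_pow_left₀ (by positivity) h43 _
        _ = 3 ^ (2 * e * Z) := by rw [← pow_mul]
        _ ≤ 3 ^ (64 * e * k) := pow_le_pow_right₀ (by norm_num) (by nlinarith)
    have u2 : |(4 : ℤ) ^ Y| ≤ 3 ^ (64 * e * k) := by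
      rw [abs_of_nonneg (by positivity)]
      calc (4 : ℤ) ^ Y ≤ (3 ^ 2) ^ Y := pow_le_pow_left₀ (by norm_num) (by norm_num) _
        _ = 3 ^ (2 * Y) := by rw [pow_mul]
        _ ≤ 3 ^ (64 * e * k) := pow_le_pow_right₀ (by norm_num) (by nlinarith)
    have u3 : (3 : ℤ) ^ (64 * e * k + 1) ≤ 3 ^ N := by
      apply pow_le_pow_right₀ (by norm_num)
      rw [hN]
      have : 0 < e * k := by positivity
      nlinarith
    have u4 := abs_sub (a ^ Z) (4 ^ Y)
    have u5 : (0 : ℤ) < 3 ^ (64 * e * k) := by positivity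
    rw [pow_succ] at u3
    linarith

/-! ### The case of large `w` -/

lemma num1_aux (k : ℕ) (hk : 70 ≤ k) : 66 * k * (k + 3) * 2 ^ (k + 1) ≤ 3 ^ (k - 1) := by
  induction k, hk using Nat.le_induction with
  | base => norm_num
  | succ k hk ih =>
    obtain ⟨j, rfl⟩ : ∃ j, k = j + 1 := ⟨k - 1, by omega⟩
    simp only [Nat.add_sub_cancel] at ih ⊢
    rw [pow_succ 3 j, pow_succ 2 (j + 1 + 1)]
    generalize 3 ^ j = u at *
    generalize 2 ^ (j + 1 + 1) = v at *
    have h1 : 66 * (j + 1 + 1) * (j + 1 + 1 + 3) * 2 ≤ 66 * (j + 1) * (j + 1 + 3) * 3 := by nlinarith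
    calc 66 * (j + 1 + 1) * (j + 1 + 1 + 3) * (v * 2)
        = (66 * (j + 1 + 1) * (j + 1 + 1 + 3) * 2) * v := by ring
      _ ≤ (66 * (j + 1) * (j + 1 + 3) * 3) * v := Nat.mul_le_mul_right _ h1
      _ = (66 * (j + 1) * (j + 1 + 3) * v) * 3 := by ring
      _ ≤ u * 3 := Nat.mul_le_mul_right _ ih

lemma num2_aux (k : ℕ) (hk : 70 ≤ k) :
    2 ^ 20 * 1025 * k ^ 2 * (2 * k + 3) ^ 4 < 81 * 2 ^ k := by
  induction k, hk using Nat.le_induction with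
  | base => norm_num
  | succ k hk ih =>
    have h1 : 10 * (k + 1) ≤ 11 * k := by omega
    have h2 : 10 * (2 * (k + 1) + 3) ≤ 11 * (2 * k + 3) := by omega
    have h3 := Nat.mul_le_mul (Nat.pow_le_pow_left h1 2) (Nat.pow_le_pow_left h2 4)
    rw [mul_pow, mul_pow, mul_pow, mul_pow] at h3
    rw [pow_succ 2 k]
    generalize 2 ^ k = v at *
    have h4 : (k + 1) ^ 2 * (2 * (k + 1) + 3) ^ 4 ≤ 2 * (k ^ 2 * (2 * k + 3) ^ 4) := by
      generalize (k + 1) ^ 2 = a1 at *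
      generalize (2 * (k + 1) + 3) ^ 4 = a2 at *
      generalize k ^ 2 = a3 at *
      generalize (2 * k + 3) ^ 4 = a4 at *
      have e1 : 10 ^ 2 * a1 * (10 ^ 4 * a2) = 1000000 * (a1 * a2) := by ring
      have e2 : 11 ^ 2 * a3 * (11 ^ 4 * a4) = 1771561 * (a3 * a4) := by ring
      rw [e1, e2] at h3
      omega
    calc 2 ^ 20 * 1025 * (k + 1) ^ 2 * (2 * (k + 1) + 3) ^ 4
        = 2 ^ 20 * 1025 * ((k + 1) ^ 2 * (2 * (k + 1) + 3) ^ 4) := by ring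
      _ ≤ 2 ^ 20 * 1025 * (2 * (k ^ 2 * (2 * k + 3) ^ 4)) := Nat.mul_le_mul_left _ h4
      _ = (2 ^ 20 * 1025 * k ^ 2 * (2 * k + 3) ^ 4) * 2 := by ring
      _ < (81 * v) * 2 := Nat.mul_lt_mul_of_pos_right ih (by norm_num)
      _ = _ := by ring

lemma num3_aux (k : ℕ) (hk : 70 ≤ k) : 82 * (k + 2) ≤ 2 ^ (k + 1) := by
  induction k, hk using Nat.le_induction with
  | base => norm_num
  | succ k hk ih =>
    rw [pow_succ]
    omega

lemma pow_dvd_aux (e w N : ℕ) (he : 0 < e) (h : 2 * e * N ≤ w) : (4 ^ e) ^ N ∣ (4 ^ e + 2) ^ w := by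
  have h1 : (4 ^ e) ^ N = 2 ^ (2 * e * N) := by
    rw [pow_mul, pow_mul]
    norm_num
  rw [h1]
  refine (pow_dvd_pow 2 h).trans (pow_dvd_pow_of_dvd ?_ w)
  have h2 : 2 ∣ 4 ^ e := dvd_pow (by norm_num) he.ne'
  omega

lemma add_rot_aux (a b c : ℕ) : a + b + c = b + (c + a) := by omega

set_option maxHeartbeats 1000000 in
lemma large_w (e x y z w k : ℕ) (he : 9 ≤ e) (hx : 0 < x) (hy : 0 < y) (hz : 0 < z) (hw : 0 < w)
    (hk : 70 ≤ k) (hk1 : 2 ^ k ≤ w) (hk2 : w < 2 ^ (k + 1))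
    (h : (4 ^ e - 1) ^ x + (4 ^ e) ^ y + (4 ^ e + 1) ^ z = (4 ^ e + 2) ^ w) : False := by
  have hn16 : 16 ≤ 4 ^ e := by
    calc 16 = 4 ^ 2 := by norm_num
      _ ≤ 4 ^ e := Nat.pow_le_pow_right (by norm_num) (by omega)
  have hzodd := z_odd_aux e x y z w hx hw h
  obtain ⟨hxw, hyw, hzw⟩ := exps_le_aux _ x y z w (by omega) h
  have hnw := w_large_aux _ x y z w hn16 hx hy hw h
  have hn2 : 4 ^ e = 2 ^ (2 * e) := by rw [pow_mul]; norm_num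
  have hek : 2 * e ≤ k + 3 := by
    have : 2 ^ (2 * e) < 2 ^ (k + 4) := by
      rw [← hn2]
      have : 2 ^ (k + 4) = 8 * 2 ^ (k + 1) := by ring
      omega
    have := (Nat.pow_lt_pow_iff_right (by norm_num)).1 this
    omega
  have n1 := num1_aux k hk
  have n2 := num2_aux k hk
  have n3 := num3_aux k hk
  -- a lower bound for `w`
  have hwbig : 2 ^ 20 * 1025 * k ^ 2 * (2 * k + 3) ^ 4 < 81 * w := by omega
  have hwx : 1025 * e * k ^ 2 < w := by
    have h1 : e ≤ (2 * k + 3) ^ 4 := le_trans (by omega) (Nat.le_self_pow (by norm_num) (2 * k + 3))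
    have h2 : 81 * (1025 * e * k ^ 2) ≤ 2 ^ 20 * 1025 * k ^ 2 * (2 * k + 3) ^ 4 := by
      calc 81 * (1025 * e * k ^ 2) = 81 * 1025 * k ^ 2 * e := by ring
        _ ≤ 2 ^ 20 * 1025 * k ^ 2 * (2 * k + 3) ^ 4 := by gcongr; norm_num
    omega
  -- the 3-adic estimate bounds `x`
  have hxle : x ≤ 1025 * e * k ^ 2 := by
    have hd : 3 ^ (min x w) ∣ (4 ^ e) ^ y + (4 ^ e + 1) ^ z := by
      have h3n : 3 ∣ 4 ^ e - 1 := by simpa using Nat.sub_dvd_pow_sub_pow 4 1 e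
      have d1 : 3 ^ (min x w) ∣ (4 ^ e - 1) ^ x :=
        (pow_dvd_pow 3 (min_le_left x w)).trans (pow_dvd_pow_of_dvd h3n x)
      have d2 : 3 ^ (min x w) ∣ (4 ^ e + 2) ^ w :=
        (pow_dvd_pow 3 (min_le_right x w)).trans (pow_dvd_pow_of_dvd (by omega) w)
      rw [← h, add_assoc] at d2
      exact (Nat.dvd_add_right d1).1 d2
    have hb := core3 e k y z (min x w) (by omega) (by omega) hy hzodd hd (by
      calc 34 * k * (e * y) + 32 * e * k * z ≤ 34 * k * (e * (2 * w)) + 32 * e * k * (2 * w) := by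
            gcongr
        _ = 66 * k * (2 * e) * w := by ring
        _ ≤ 66 * k * (k + 3) * 2 ^ (k + 1) := by gcongr
        _ ≤ _ := n1)
    have h5 : 1024 * e * k ^ 2 + k ≤ 1025 * e * k ^ 2 := by
      have : 1 * k ≤ e * k ^ 2 := by
        apply Nat.mul_le_mul (by omega)
        exact Nat.le_self_pow (by norm_num) k
      nlinarith
    have h6 : min x w < 1025 * e * k ^ 2 := by omega
    rcases min_lt_iff.1 h6 with h7 | h7 <;> omega
  obtain ⟨μ, hμ⟩ : ∃ μ, μ = k / e + 2 := ⟨_, rfl⟩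
  have hμ2 : 2 ≤ μ := by rw [hμ]; exact Nat.le_add_left 2 _
  have heμ : e * μ ≤ 2 * k + 3 := by
    have := Nat.mul_div_le k e
    rw [hμ, mul_add]
    omega
  have hμk : μ ≤ k + 2 := by
    have := Nat.div_le_self k e
    omega
  have hμn : 2 ^ (2 * k + 2) ≤ (4 ^ e) ^ (μ - 1) := by
    rw [hn2, ← pow_mul]
    apply Nat.pow_le_pow_right (by norm_num)
    have h1 : k < e * (k / e + 1) := by
      have := Nat.lt_mul_div_succ k (show 0 < e by omega)
      simpa using this
    have h2 : μ - 1 = k / e + 1 := by omega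
    rw [h2, mul_assoc]
    omega
  obtain ⟨N, hN⟩ : ∃ N, N = 512 * x * μ ^ 2 := ⟨_, rfl⟩
  have hN0 : 0 < N := by rw [hN]; positivity
  have hNx : x ≤ N := by
    rw [hN]
    have : 1 ≤ μ ^ 2 := Nat.one_le_pow _ _ (by omega)
    nlinarith
  have hwN : 2 * e * (512 * (N + 1) * μ ^ 2) ≤ w := by
    have h1 : 81 * (2 * e * (512 * (N + 1) * μ ^ 2)) ≤
        2 ^ 20 * 1025 * k ^ 2 * (2 * k + 3) ^ 4 := by
      have he2 : 81 ≤ e ^ 2 := by nlinarith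
      calc 81 * (2 * e * (512 * (N + 1) * μ ^ 2)) ≤ 81 * (2 * e * (512 * (2 * N) * μ ^ 2)) := by
            gcongr; omega
        _ = 2 ^ 20 * 81 * e * x * μ ^ 4 := by rw [hN]; ring
        _ ≤ 2 ^ 20 * e ^ 2 * e * (1025 * e * k ^ 2) * μ ^ 4 := by gcongr
        _ = 2 ^ 20 * 1025 * k ^ 2 * (e * μ) ^ 4 := by ring
        _ ≤ _ := by gcongr
    omega
  have hNw : N + 1 ≤ w := by
    refine le_trans ?_ hwN
    have : 1 ≤ e * μ ^ 2 := Nat.one_le_iff_ne_zero.2 (by positivity)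
    calc N + 1 ≤ 1024 * (N + 1) * 1 := by omega
      _ ≤ 1024 * (N + 1) * (e * μ ^ 2) := Nat.mul_le_mul_left _ this
      _ = _ := by ring
  have hXb : ∀ β, β ≤ w → (16 * β * μ + 2 * μ) + 32 * μ * z ≤ (4 ^ e) ^ (μ - 1) := by
    intro β hβ
    refine le_trans ?_ hμn
    calc (16 * β * μ + 2 * μ) + 32 * μ * z ≤ (16 * w * μ + 2 * μ * w) + 32 * μ * (2 * w) := by
          have : 2 * μ ≤ 2 * μ * w := Nat.le_mul_of_pos_right _ hw
          gcongr
      _ = 82 * μ * w := by ring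
      _ ≤ 82 * (k + 2) * 2 ^ (k + 1) := by gcongr
      _ ≤ 2 ^ (k + 1) * 2 ^ (k + 1) := Nat.mul_le_mul_right _ n3
      _ = 2 ^ (2 * k + 2) := by rw [← pow_add]; congr 1; ring
  -- first application: `y < N`
  have hyN : y < N := by
    by_contra hc
    push Not at hc
    apply core2 (4 ^ e) z x μ ((4 ^ e - 1) ^ x) hn16 hμ2 hx hz (Nat.pow_pos (by omega))
      (Nat.pow_le_pow_left (by omega) x)
    · rw [← hN]
      have d1 : (4 ^ e) ^ N ∣ (4 ^ e) ^ y := pow_dvd_pow _ hc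
      have d2 : (4 ^ e) ^ N ∣ (4 ^ e + 2) ^ w := by
        apply pow_dvd_aux e w N (by omega)
        refine le_trans ?_ hwN
        have : 1 ≤ μ ^ 2 := Nat.one_le_pow _ _ (by omega)
        apply Nat.mul_le_mul_left
        nlinarith
      rw [← h] at d2
      have d3 : (4 ^ e - 1) ^ x + (4 ^ e) ^ y + (4 ^ e + 1) ^ z =
          (4 ^ e) ^ y + ((4 ^ e + 1) ^ z + (4 ^ e - 1) ^ x) := add_rot_aux _ _ _
      rw [d3] at d2
      exact (Nat.dvd_add_right d1).1 d2
    · exact hXb x (by omega)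
  -- second application
  apply core2 (4 ^ e) z (N + 1) μ ((4 ^ e - 1) ^ x + (4 ^ e) ^ y) hn16 hμ2 (by omega) hz
    (by positivity)
  · have u1 : (4 ^ e - 1) ^ x ≤ (4 ^ e) ^ N :=
      (Nat.pow_le_pow_left (by omega) x).trans (Nat.pow_le_pow_right (by omega) hNx)
    have u2 : (4 ^ e) ^ y ≤ (4 ^ e) ^ N := Nat.pow_le_pow_right (by omega) hyN.le
    rw [pow_succ]
    have u3 : (4 ^ e) ^ N * 2 ≤ (4 ^ e) ^ N * 4 ^ e := Nat.mul_le_mul_left _ (by omega)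
    omega
  · have d3 : (4 ^ e + 1) ^ z + ((4 ^ e - 1) ^ x + (4 ^ e) ^ y) = (4 ^ e + 2) ^ w := by
      rw [← h, add_comm]
    rw [d3]
    exact pow_dvd_aux e w _ (by omega) hwN
  · exact hXb (N + 1) hNw

/-! ### Certificates for the case of small `w` -/

def certThree : List (ℕ × ℕ × ℤ) := [
  (19137218960157227069446997576711538654922648805939, 4712104407424723088584, -18041794404128188157835298591),
  (143476457996120187765126891938543195748880600072492, 2795017942358864896028, 35040385265555630213791810307),
  (87897839454564818555752698554447643408600515557353, 4201047933866896679654, -50910921836098794061861340559),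
  (225435686482334583712641074750841919789931158228925, 9082836586927225229374, 5480271343471472509458405953),
  (152425053411595795716317464184055330032458029890641, 87071167582058572436185, -2739869359859788226718400412),
  (123069332970907588351734238176902334524463726862746, 2582381962874678845100, 60725998302018375446679035601),
  (208672954996799979489499971593901509514259009033991, 2514100434915038318797, 12105160681011842525010971378),
  (139597510408750899409591946544636265607521349039683, 9007095027386945635688, 34235281189900119470837284595),
  (135778774245417115182907276385079294690553995091866, 73553227269259259521603, 1867004869983955372982026563),
  (206180452876846592637498899554664703927148353247475, 2905240929488184513568, -98714192580463715863763014951),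
  (213759649103620193077280370896837662984831756624252, 3825497297564376162973, -4829927845126017609741711443),
  (28313834971531666910355128446485947264581082118399, 3476586085259154355087, 4980263458618144990208127666),
  (8370317220098729914593013178915043404123086426892, 3504371412810758308255, 77300665937294660792602732496),
  (232973270554022120924780747923648967694198449865709, 2568251648924981065703, 32454319864230724360946730191),
  (364425512004141973976336527602245961523766373756579, 2736506673023689166116, -45383738581165238672531926293),
  (197693781236130248973021351691607528623662752196167, 147896790004634736877813, -2057510286657606281981121289),
  (350728350054871059196450279870704476711324470357204, 3270949953191996047426, 24601435253206788859034258701),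
  (373671252034203521642130039268780485328069926386316, 3047184296506387761545, -35344600676546270873925609339),
  (69918237220942570599173804630342819017107011885447, 95706059793243981726745, -475561163137366980651863434),
  (264871559808461726498495397091848287231822259204466, 7220203863319550743309, 44182497431515589294930705752),
  (218507378698286029339885971956499801748418205829659, 13631155536068608518257, 15159221748571922745893296305),
  (324599871973262517076444950916103387031833961058310, 2899860355435474442737, -36140383697424711637190425369),
  (138228529306496120222971747287834841328410848085192, 182739958386173044488833, -203638459513424193751252651),
  (273798469058571433465924855366555868574405922254750, 2786632215055603933886, -35636308248075239613535895097),
  (136815774721523742502165237835444429248765847153537, 2662117309947613422019, 76873601654351059109606050892),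
  (359288702573037011392539022926756193056612949712317, 12124054722815978891347, -16605177797268574210614240692),
  (73836335545610802544690614136261017420279560451240, 3927094921980354039707, 38376278979307419584734888422),
  (337768437643110423429641950466235552379337212960091, 2640394497784817965303, -54625002312212579282782196245)]

def certTwo : List (ℕ × ℕ × ℕ × ℕ × ℕ) := [
  (9, 19, 6, 3, 385888373419067697511268333),
  (9, 19, 6, 5, 954214554659123881932226541),
  (9, 19, 6, 0, 335249257382916614127878125),
  (9, 55, 6, 3, 688863600125041399365369801),
  (9, 55, 6, 5, 25709940076801329880891337),
  (9, 55, 6, 0, 644684682085974336975667145),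
  (9, 91, 6, 3, 985718639869216041022521253),
  (9, 91, 6, 5, 335145364779859052728680357),
  (9, 91, 6, 0, 954120106789032059823456165),
  (10, 21, 6, 3, 765572978090748937248539934699),
  (10, 21, 6, 5, 79219548907711508650470146027),
  (10, 21, 6, 0, 713046057947645824027996454891),
  (10, 61, 6, 3, 552252778475863715393882292163),
  (10, 61, 6, 5, 1135580944944125125490295963587),
  (10, 61, 6, 0, 501756853755830039371119067075),
  (10, 101, 6, 3, 336998297549595086859694768027),
  (10, 101, 6, 5, 924291740752309340833418575771),
  (10, 101, 6, 0, 290467649564014254714241679259),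
  (11, 23, 5, 3, 64473602593427899331641321),
  (11, 23, 5, 0, 296589093953397221759123433),
  (11, 67, 5, 3, 12888168234627648018448317),
  (11, 67, 5, 0, 245006906221553943327014845),
  (12, 25, 5, 3, 23108044454993788817421369319),
  (12, 25, 5, 0, 3301124246773299069965041639),
  (12, 73, 5, 3, 23107723334066198281300475831),
  (12, 73, 5, 0, 3301029799436886276814405559),
  (13, 27, 5, 3, 7605891889900433590063680454629),
  (13, 27, 5, 0, 2535297800352530338252071108581),
  (13, 79, 5, 3, 10986271226125083664373786869681),
  (13, 79, 5, 0, 5915692852612835402741448703921),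
  (14, 29, 4, 3, 14507108718482834723962851),
  (14, 29, 4, 0, 4835702233623395364241379),
  (14, 85, 4, 3, 14507106700870186629595051),
  (14, 85, 4, 0, 4835700216010747269873579),
  (15, 31, 4, 3, 309484990798140209425809377),
  (15, 31, 4, 0, 928455011593751851482218465),
  (15, 91, 4, 3, 309484956210495006795890597),
  (15, 91, 4, 0, 928454977006106648852299685),
  (16, 33, 4, 3, 59421121562880231763506888671),
  (16, 33, 4, 0, 19807040324194807040444465119),
  (16, 97, 4, 3, 59421120972584421129923329951),
  (16, 97, 4, 0, 19807039733898996406860906399),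
  (17, 35, 4, 3, 1267650594767993155077380505565),
  (17, 35, 4, 0, 3802951795519599863250139742173),
  (17, 103, 4, 3, 1267650584732964377811153321881),
  (17, 103, 4, 0, 3802951785484571085983912558489),
  (18, 37, 4, 3, 243388915151733898668866313125851),
  (18, 37, 4, 0, 81129638327242901760157948051419),
  (19, 39, 4, 3, 5192296856985891422138532460756953),
  (19, 39, 4, 0, 15576890574131104542925439442616281),
  (20, 41, 4, 3, 996920996812694999556095687977336791),
  (20, 41, 4, 0, 332306998921445988923806787011870679),
  (21, 43, 3, 0, 9671406556727917397671893),
  (22, 45, 3, 0, 154742504909880885990391763),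
  (23, 47, 3, 0, 2475880078567453218821898193),
  (24, 49, 3, 0, 39614081257118376522913152975),
  (25, 51, 3, 0, 633825300114057279853102628813),
  (26, 53, 3, 0, 10141204801825596521193375006667),
  (27, 55, 3, 0, 162259276829212372599659988778953),
  (28, 57, 3, 0, 2596148429267409706982388002717639),
  (29, 59, 3, 0, 41538374868278604022651777682767813),
  (30, 61, 3, 0, 664613997892457866123691749122506691),
  (31, 63, 3, 0, 10633823966279326692694237321317318593),
  (32, 65, 3, 0, 170141183460469230532648938924763250623),
  (33, 67, 3, 0, 2722258935367507702763269447699985858493),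
  (34, 69, 3, 0, 43556142965880123302946744293890986082235),
  (35, 71, 3, 0, 696898287454081973089169190949325094518713),
  (36, 73, 3, 0, 11150372599265311570423126383074696652390327)]

def pmod : ℕ → ℕ → ℕ → ℕ → ℕ
  | 0, _, _, m => 1 % m
  | f + 1, b, k, m =>
    bif Nat.beq (k % 2) 1 then b * pmod f (b * b % m) (k / 2) m % m
    else pmod f (b * b % m) (k / 2) m

lemma pmod_modEq (f : ℕ) : ∀ b k m : ℕ, k < 2 ^ f → pmod f b k m ≡ b ^ k [MOD m] := by
  induction f with
  | zero =>
    intro b k m hk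
    have : k = 0 := by simpa using hk
    subst this
    simpa [pmod] using Nat.mod_modEq 1 m
  | succ f ih =>
    intro b k m hk
    have h1 : pmod f (b * b % m) (k / 2) m ≡ (b * b) ^ (k / 2) [MOD m] :=
      (ih (b * b % m) (k / 2) m (by rw [pow_succ] at hk; omega)).trans ((Nat.mod_modEq _ m).pow _)
    rw [← sq, ← pow_mul] at h1
    rcases Nat.mod_two_eq_zero_or_one k with h2 | h2
    · simp only [pmod, h2]
      have : 2 * (k / 2) = k := by omega
      rw [this, sq] at h1
      exact h1
    · simp only [pmod, h2]
      have h3 : k = 2 * (k / 2) + 1 := by omega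
      have h4 : b ^ k = b * b ^ (2 * (k / 2)) := by
        conv_lhs => rw [h3]
        rw [pow_succ, mul_comm]
      rw [h4, sq] at *
      exact (Nat.mod_modEq _ m).trans (h1.mul_left b)

def okThree (e g q : ℕ) (r : ℤ) : Bool :=
  decide (g < 2 ^ 200) &&
  decide ((pmod 200 4 g (3 ^ 107) + (4 ^ e + 1)) % 3 ^ 107 = 0) &&
  decide (2 ^ 71 ≤ q) && decide (Nat.gcd q r.natAbs = 1) &&
  decide (((q : ℤ) * g - r) % 3 ^ 106 = 0) &&
  decide ((r.natAbs + q * e) * 2 ^ 71 < 3 ^ 106)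

def okTwo (e x j y z : ℕ) : Bool :=
  decide (z < 2 ^ 200) &&
  decide ((pmod 200 (4 ^ e + 1) z ((4 ^ e) ^ j) + ((4 ^ e - 1) ^ x +
    bif Nat.beq y 0 then 0 else (4 ^ e) ^ y)) % (4 ^ e) ^ j = 0) &&
  decide (2 ^ 71 ≤ z) && decide (z < (4 ^ e) ^ (j - 1)) && decide (1 ≤ j) && decide (j ≤ 6) &&
  (decide (y = 0) || decide (y = 3) || decide (y = 5))

lemma certThree_ok : (List.range 28).all (fun i =>
    let c := certThree.getD i (0, 0, 0)
    okThree (i + 9) c.1 c.2.1 c.2.2) = true := by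
  decide +kernel

lemma certTwo_ok : certTwo.all (fun c => okTwo c.1 c.2.1 c.2.2.1 c.2.2.2.1 c.2.2.2.2) = true := by
  decide +kernel

lemma certTwo_cover : (List.range 28).all (fun i => [1, 3, 5].all (fun q =>
    decide (107 ≤ 2 * (i + 9) * q + 1) || [3, 5, 7].all (fun y =>
      certTwo.any (fun c => decide (c.1 = i + 9) && decide (c.2.1 = 2 * (i + 9) * q + 1) &&
        (decide (c.2.2.2.1 = y) || (decide (c.2.2.2.1 = 0) && decide (c.2.2.1 ≤ y))))))) = true := by
  decide +kernel

lemma three_dvd_aux (d j : ℕ) (h : (3 : ℤ) ^ (j + 1) ∣ 4 ^ d - 1) : 3 ^ j ∣ d := by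
  have lte := Int.emultiplicity_pow_sub_pow Nat.prime_three (by decide) (x := 4)
      (y := 1) (by norm_num) (by norm_num) d
  rw [one_pow] at lte
  have h1 : ((j + 1 : ℕ) : ℕ∞) ≤ emultiplicity ((3 : ℕ) : ℤ) (4 ^ d - 1) :=
    le_emultiplicity_of_pow_dvd (by exact_mod_cast h)
  rw [lte] at h1
  by_contra hc
  have h2 : emultiplicity 3 d < (j : ℕ∞) := emultiplicity_lt_iff_not_dvd.2 hc
  have h3 : emultiplicity ((3 : ℕ) : ℤ) (4 - 1) < ((2 : ℕ) : ℕ∞) :=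
    emultiplicity_lt_iff_not_dvd.2 (by norm_num)
  have h4 : emultiplicity ((3 : ℕ) : ℤ) (4 - 1) ≤ 1 := Order.le_of_lt_succ (by exact_mod_cast h3)
  have h5 : emultiplicity ((3 : ℕ) : ℤ) (4 - 1) + emultiplicity 3 d < ((j + 1 : ℕ) : ℕ∞) := by
    calc _ ≤ 1 + emultiplicity 3 d := by gcongr
      _ < 1 + (j : ℕ∞) := by
          exact (ENat.add_lt_add_iff_left (by simp)).2 h2
      _ = _ := by push_cast; rw [add_comm]
  exact absurd (lt_of_le_of_lt h1 h5) (lt_irrefl _)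

/-- If `4 ^ u ≡ 4 ^ v` modulo `3 ^ (j + 1)` then `u ≡ v` modulo `3 ^ j`. -/
lemma three_log_aux (u v j : ℕ) (h : (3 : ℤ) ^ (j + 1) ∣ 4 ^ u - 4 ^ v) :
    (3 : ℤ) ^ j ∣ (u : ℤ) - v := by
  wlog huv : v ≤ u generalizing u v
  · have := this v u (by rw [← neg_sub]; exact (dvd_neg).2 h) (by omega)
    rw [← neg_sub]
    exact (dvd_neg).2 this
  obtain ⟨d, rfl⟩ := Nat.exists_eq_add_of_le huv
  have h1 : (4 : ℤ) ^ (v + d) - 4 ^ v = 4 ^ v * (4 ^ d - 1) := by ring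
  rw [h1] at h
  have h2 : IsCoprime ((3 : ℤ) ^ (j + 1)) (4 ^ v) := IsCoprime.pow ⟨-1, 1, by norm_num⟩
  have h3 := h2.dvd_of_dvd_mul_left h
  have h5 : ((v + d : ℕ) : ℤ) - v = d := by push_cast; ring
  rw [h5]
  have h4 := three_dvd_aux d j h3
  exact_mod_cast h4

lemma two_dvd_aux (f d m : ℕ) (hf : 2 ≤ f) (h : (2 : ℤ) ^ (f + m) ∣ (2 ^ f + 1) ^ d - 1) :
    (2 : ℤ) ^ m ∣ d := by
  have h4 : (4 : ℤ) ∣ 2 ^ f := by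
    have := pow_dvd_pow (2 : ℤ) hf
    norm_num at this
    exact this
  have lte := Int.two_pow_sub_pow' (x := (2 : ℤ) ^ f + 1) (y := 1) d (by simpa using h4)
    (by omega)
  rw [one_pow, add_sub_cancel_right] at lte
  have h1 : ((f + m : ℕ) : ℕ∞) ≤ emultiplicity (2 : ℤ) ((2 ^ f + 1) ^ d - 1) :=
    le_emultiplicity_of_pow_dvd h
  rw [lte] at h1
  by_contra hc
  have h2 : emultiplicity (2 : ℤ) d < (m : ℕ∞) := emultiplicity_lt_iff_not_dvd.2 hc
  have h3 : emultiplicity (2 : ℤ) (2 ^ f) < ((f + 1 : ℕ) : ℕ∞) :=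
    emultiplicity_lt_iff_not_dvd.2 (by
      intro h
      have := Int.le_of_dvd (by positivity) h
      rw [pow_succ] at this
      have : (0 : ℤ) < 2 ^ f := by positivity
      linarith)
  have h4 : emultiplicity (2 : ℤ) (2 ^ f) ≤ f := by
    apply (ENat.lt_add_one_iff (by simp)).1
    exact_mod_cast h3
  have h5 : emultiplicity (2 : ℤ) (2 ^ f) + emultiplicity (2 : ℤ) d < ((f + m : ℕ) : ℕ∞) := by
    calc _ ≤ (f : ℕ∞) + emultiplicity (2 : ℤ) d := by gcongr
      _ < (f : ℕ∞) + (m : ℕ∞) := by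
          exact (ENat.add_lt_add_iff_left (by simp)).2 h2
      _ = _ := by push_cast; rfl
  exact absurd (lt_of_le_of_lt h1 h5) (lt_irrefl _)

lemma small_three (e y z g q : ℕ) (r : ℤ) (hy : 0 < y) (he : 0 < e) (hz : Odd z)
    (hy2 : y < 2 ^ 71) (hz2 : z < 2 ^ 71)
    (hok : okThree e g q r = true) (h : 3 ^ 107 ∣ (4 ^ e) ^ y + (4 ^ e + 1) ^ z) : False := by
  unfold okThree at hok
  simp only [Bool.and_eq_true, decide_eq_true_eq] at hok
  obtain ⟨⟨⟨⟨⟨c1, c2⟩, c3⟩, c4⟩, c5⟩, c6⟩ := hok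
  have p1 := pmod_modEq 200 4 g (3 ^ 107) c1
  have p2 : 3 ^ 107 ∣ 4 ^ g + (4 ^ e + 1) :=
    (Nat.modEq_zero_iff_dvd).1 ((p1.add_right _).symm.trans c2)
  clear c2 p1 c1
  have p3 : (3 : ℤ) ^ 107 ∣ 4 ^ g + (4 ^ e + 1) := by
    have := Int.natCast_dvd_natCast.2 p2
    push_cast at this
    exact this
  have p4 : (3 : ℤ) ^ 107 ∣ (4 ^ e) ^ y + (4 ^ e + 1) ^ z := by
    have := Int.natCast_dvd_natCast.2 h
    push_cast at this
    exact this
  have p5 : (3 : ℤ) ^ (106 + 1) ∣ 4 ^ (g * z) - 4 ^ (e * y) := by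
    have s1 : (4 : ℤ) ^ g - (-(4 ^ e + 1)) ∣ (4 ^ g) ^ z - (-(4 ^ e + 1)) ^ z :=
      sub_dvd_pow_sub_pow _ _ _
    rw [hz.neg_pow, sub_neg_eq_add, sub_neg_eq_add] at s1
    have s2 := dvd_sub (p3.trans s1) p4
    have s3 : (4 : ℤ) ^ (g * z) - 4 ^ (e * y) =
        (4 ^ g) ^ z + (4 ^ e + 1) ^ z - ((4 ^ e) ^ y + (4 ^ e + 1) ^ z) := by
      rw [pow_mul, pow_mul]
      abel
    rw [s3]
    exact s2
  have p6 := three_log_aux _ _ _ p5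
  have p7 : (3 : ℤ) ^ 106 ∣ r * z - q * (e * y) := by
    have s1 : (3 : ℤ) ^ 106 ∣ (q : ℤ) * g - r := Int.dvd_of_emod_eq_zero c5
    have s2 := dvd_sub (p6.mul_left (q : ℤ)) (s1.mul_right (z : ℤ))
    have s3 : r * z - q * (e * y) =
        (q : ℤ) * (((g * z : ℕ) : ℤ) - ((e * y : ℕ) : ℤ)) - (q * g - r) * z := by
      push_cast
      ring
    rw [s3]
    exact s2
  have p8 : r * z - q * (e * y) = 0 := by
    apply Int.eq_zero_of_abs_lt_dvd p7
    have s1 : |r * z - q * (e * y)| ≤ |r| * z + q * (e * y) := by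
      refine (abs_sub _ _).trans ?_
      rw [abs_mul, Nat.abs_cast, abs_of_nonneg (by positivity : (0 : ℤ) ≤ (q : ℤ) * (e * y))]
    refine lt_of_le_of_lt s1 ?_
    rw [Int.abs_eq_natAbs]
    have s2 : r.natAbs * z + q * (e * y) < 3 ^ 106 := by
      refine lt_of_le_of_lt ?_ c6
      calc r.natAbs * z + q * (e * y) ≤ r.natAbs * 2 ^ 71 + q * (e * 2 ^ 71) := by gcongr
        _ = _ := by ring
    exact_mod_cast s2
  have p9 : (q : ℤ) ∣ r * z := ⟨e * y, by linarith⟩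
  have p10 : q ∣ r.natAbs * z := by
    have := Int.natAbs_dvd_natAbs.2 p9
    rw [Int.natAbs_mul] at this
    simpa using this
  have p11 : q ∣ z := (Nat.Coprime.dvd_of_dvd_mul_left c4 p10)
  have := Nat.le_of_dvd hz.pos p11
  omega

lemma small_two (e x y z j y0 z0 : ℕ) (he : 0 < e) (hz2 : z < 2 ^ 71)
    (hok : okTwo e x j y0 z0 = true) (hy : y0 = y ∨ (y0 = 0 ∧ j ≤ y)) (hy0 : 0 < y)
    (h : (4 ^ e) ^ j ∣ (4 ^ e - 1) ^ x + (4 ^ e) ^ y + (4 ^ e + 1) ^ z) : False := by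
  unfold okTwo at hok
  simp only [Bool.and_eq_true, decide_eq_true_eq] at hok
  obtain ⟨⟨⟨⟨⟨⟨c1, c2⟩, c3⟩, c4⟩, c5⟩, c6⟩, c7⟩ := hok
  have p1 := pmod_modEq 200 (4 ^ e + 1) z0 ((4 ^ e) ^ j) c1
  have p2 : (4 ^ e) ^ j ∣ (4 ^ e + 1) ^ z0 + ((4 ^ e - 1) ^ x +
      bif Nat.beq y0 0 then 0 else (4 ^ e) ^ y0) :=
    (Nat.modEq_zero_iff_dvd).1 ((p1.add_right _).symm.trans c2)
  have p3 : (4 ^ e) ^ j ∣ (4 ^ e + 1) ^ z0 + ((4 ^ e - 1) ^ x + (4 ^ e) ^ y) := by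
    rcases hy with rfl | ⟨rfl, hj⟩
    · obtain ⟨y', rfl⟩ : ∃ y', y0 = y' + 1 := ⟨y0 - 1, by omega⟩
      exact p2
    · have : (4 ^ e) ^ j ∣ (4 ^ e) ^ y := pow_dvd_pow _ hj
      have p4 := dvd_add p2 this
      simpa [add_assoc] using p4
  have p4 : (4 ^ e + 1) ^ z0 ≡ (4 ^ e + 1) ^ z [MOD (4 ^ e) ^ j] := by
    have s1 := (Nat.modEq_zero_iff_dvd).2 p3
    have s2 := (Nat.modEq_zero_iff_dvd).2 h
    rw [add_comm ((4 ^ e - 1) ^ x + (4 ^ e) ^ y)] at s2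
    exact Nat.ModEq.add_right_cancel' _ (s1.trans s2.symm)
  obtain ⟨d, rfl⟩ : ∃ d, z0 = z + d := Nat.exists_eq_add_of_le (by omega)
  have p5 : (4 ^ e + 1) ^ d ≡ 1 [MOD (4 ^ e) ^ j] := by
    apply Nat.ModEq.cancel_left_of_coprime (c := (4 ^ e + 1) ^ z)
    · apply Nat.Coprime.pow
      simp
    · rw [mul_one, ← pow_add]
      exact p4
  have hn2 : (4 : ℕ) ^ e = 2 ^ (2 * e) := by rw [pow_mul]; norm_num
  have p6 : (2 : ℤ) ^ (2 * e + 2 * e * (j - 1)) ∣ (2 ^ (2 * e) + 1) ^ d - 1 := by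
    have s1 := (Nat.modEq_iff_dvd).1 p5.symm
    push_cast at s1
    have s2 : (4 : ℤ) ^ e = 2 ^ (2 * e) := by rw [pow_mul]; norm_num
    rw [s2, ← pow_mul] at s1
    have s3 : 2 * e + 2 * e * (j - 1) = 2 * e * j := by
      obtain ⟨i, rfl⟩ : ∃ i, j = i + 1 := ⟨j - 1, by omega⟩
      rw [Nat.add_sub_cancel]; ring
    rw [s3]
    exact s1
  have p7 := two_dvd_aux (2 * e) d _ (by omega) p6
  have p8 : 2 ^ (2 * e * (j - 1)) ∣ d := by exact_mod_cast p7
  have p9 := Nat.le_of_dvd (by omega) p8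
  rw [hn2, ← pow_mul] at c4
  omega

lemma y_ne_one_aux (e x z w : ℕ) (he : 0 < e) (hx : Odd x) (hz : Odd z) (hw : 2 * e * 2 ≤ w)
    (h : (4 ^ e - 1) ^ x + (4 ^ e) ^ 1 + (4 ^ e + 1) ^ z = (4 ^ e + 2) ^ w) : False := by
  have hd : 2 * 4 ^ e ∣ (4 ^ e + 2) ^ w := by
    refine Dvd.dvd.trans ?_ (pow_dvd_aux e w 2 he hw)
    rw [sq]
    exact Nat.mul_dvd_mul_right (dvd_pow (by norm_num) he.ne') _
  rw [← h] at hd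
  have h2 : 2 ∣ 4 ^ e := dvd_pow (by norm_num) he.ne'
  have h0 : 0 < 4 ^ e := by positivity
  generalize 4 ^ e = n at *
  obtain ⟨a, rfl⟩ := hx
  obtain ⟨b, rfl⟩ := hz
  obtain ⟨m, rfl⟩ := h2
  have e1 : (2 * m - 1) ^ (2 * a + 1) ≡ 2 * m - 1 [MOD 2 * (2 * m)] := by
    have s1 : (2 * m - 1) ^ 2 ≡ 1 [MOD 2 * (2 * m)] := by
      obtain ⟨i, rfl⟩ : ∃ i, m = i + 1 := ⟨m - 1, by omega⟩
      have : (2 * (i + 1) - 1) ^ 2 = 1 + 2 * (2 * (i + 1)) * i := by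
        rw [show 2 * (i + 1) - 1 = 2 * i + 1 by omega]; ring
      rw [this]
      exact (Nat.modEq_iff_dvd' (by omega)).2 (by simp) |>.symm
    rw [pow_succ, pow_mul]
    simpa using (s1.pow a).mul_right (2 * m - 1)
  have e2 : (2 * m + 1) ^ (2 * b + 1) ≡ 2 * m + 1 [MOD 2 * (2 * m)] := by
    have s1 : (2 * m + 1) ^ 2 ≡ 1 [MOD 2 * (2 * m)] := by
      have : (2 * m + 1) ^ 2 = 1 + 2 * (2 * m) * (m + 1) := by ring
      rw [this]
      exact (Nat.modEq_iff_dvd' (by omega)).2 (by simp) |>.symm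
    rw [pow_succ, pow_mul]
    simpa using (s1.pow b).mul_right (2 * m + 1)
  have e3 := (e1.add_right ((2 * m) ^ 1)).add e2
  have e4 := e3.symm.trans ((Nat.modEq_zero_iff_dvd).2 hd)
  have e5 := (Nat.modEq_zero_iff_dvd).1 e4
  obtain ⟨c, hc⟩ := e5
  rw [pow_one] at hc
  have e6 : 6 * m = 4 * m * c := by
    have : 4 * m * c = 2 * (2 * m) * c := by ring
    omega
  have e7 : m * 3 = m * (2 * c) := by nlinarith
  have := Nat.eq_of_mul_eq_mul_left (by omega) e7
  omega

lemma small_w (e x y z w : ℕ) (he : 9 ≤ e) (hx : 0 < x) (hy : 0 < y) (hz : 0 < z) (hw : 0 < w)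
    (hk2 : w < 2 ^ 70)
    (h : (4 ^ e - 1) ^ x + (4 ^ e) ^ y + (4 ^ e + 1) ^ z = (4 ^ e + 2) ^ w) : False := by
  have hn16 : 16 ≤ 4 ^ e := by
    calc 16 = 4 ^ 2 := by norm_num
      _ ≤ 4 ^ e := Nat.pow_le_pow_right (by norm_num) (by omega)
  have hzodd := z_odd_aux e x y z w hx hw h
  obtain ⟨hyodd, q, hq, hxq⟩ := xy_aux e x y z w (by omega) hz h
  obtain ⟨hxw, hyw, hzw⟩ := exps_le_aux _ x y z w (by omega) h
  have hnw := w_large_aux _ x y z w hn16 hx hy hw h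
  have hn2 : 4 ^ e = 2 ^ (2 * e) := by rw [pow_mul]; norm_num
  have he36 : e ≤ 36 := by
    have : 2 ^ (2 * e) < 2 ^ 73 := by
      rw [← hn2]
      omega
    have := (Nat.pow_lt_pow_iff_right (by norm_num)).1 this
    omega
  have hw12 : 2 * e * 6 ≤ w ∧ 107 ≤ w := by
    have : 4 ^ 9 ≤ 4 ^ e := Nat.pow_le_pow_right (by norm_num) he
    norm_num at this
    omega
  obtain ⟨i, rfl⟩ : ∃ i, e = i + 9 := ⟨e - 9, by omega⟩
  have hi : i ∈ List.range 28 := List.mem_range.2 (by omega)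
  by_cases hx107 : 107 ≤ x
  · have hd : 3 ^ 107 ∣ (4 ^ (i + 9)) ^ y + (4 ^ (i + 9) + 1) ^ z := by
      have h3n : 3 ∣ 4 ^ (i + 9) - 1 := by simpa using Nat.sub_dvd_pow_sub_pow 4 1 (i + 9)
      have d1 : 3 ^ 107 ∣ (4 ^ (i + 9) - 1) ^ x :=
        (pow_dvd_pow 3 hx107).trans (pow_dvd_pow_of_dvd h3n x)
      have d2 : 3 ^ 107 ∣ (4 ^ (i + 9) + 2) ^ w :=
        (pow_dvd_pow 3 hw12.2).trans (pow_dvd_pow_of_dvd (by omega) w)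
      rw [← h, add_assoc] at d2
      exact (Nat.dvd_add_right d1).1 d2
    have hc := List.all_eq_true.1 certThree_ok i hi
    exact small_three (i + 9) y z _ _ _ hy (by omega) hzodd (by omega) (by omega) hc hd
  · push Not at hx107
    have hxodd : Odd x := ⟨(i + 9) * q, by rw [hxq]; ring⟩
    have hq5 : q ∈ [1, 3, 5] := by
      have h1 : 2 * (0 + 9) * q ≤ 2 * (i + 9) * q := by
        gcongr
      have h2 : q ≤ 5 := by omega
      obtain ⟨t, rfl⟩ := hq
      have : t = 0 ∨ t = 1 ∨ t = 2 := by omega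
      rcases this with rfl | rfl | rfl <;> simp
    have hy1 : y ≠ 1 := by
      rintro rfl
      exact y_ne_one_aux (i + 9) x z w (by omega) hxodd hzodd (by omega) h
    have c1 := List.all_eq_true.1 (List.all_eq_true.1 certTwo_cover i hi) q hq5
    rw [Bool.or_eq_true, decide_eq_true_eq] at c1
    have c2 := c1.resolve_left (by omega)
    have key : ∀ y1 ∈ [3, 5, 7], (y1 = y ∨ (y1 = 7 ∧ 7 ≤ y)) → False := by
      intro y1 hy1m hyy
      have c3 := List.all_eq_true.1 c2 y1 hy1m
      obtain ⟨c, hc, hcc⟩ := List.any_eq_true.1 c3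
      simp only [Bool.and_eq_true, Bool.or_eq_true, decide_eq_true_eq] at hcc
      obtain ⟨⟨k1, k2⟩, k3⟩ := hcc
      have hok := List.all_eq_true.1 certTwo_ok c hc
      have hok2 := hok
      unfold okTwo at hok2
      simp only [Bool.and_eq_true, Bool.or_eq_true, decide_eq_true_eq] at hok2
      obtain ⟨⟨⟨⟨⟨⟨-, -⟩, -⟩, -⟩, -⟩, k6⟩, k7⟩ := hok2
      rw [k1, k2, ← hxq] at hok
      refine small_two (i + 9) x y z _ _ _ (by omega) (by omega) hok (by omega) hy ?_
      rw [h]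
      refine (pow_dvd_pow _ k6).trans (pow_dvd_aux _ _ _ (by omega) hw12.1)
    obtain ⟨t, ht⟩ := hyodd
    by_cases h3 : y = 3
    · exact key 3 (by simp) (Or.inl h3.symm)
    by_cases h5 : y = 5
    · exact key 5 (by simp) (Or.inl h5.symm)
    · exact key 7 (by simp) (Or.inr ⟨rfl, by omega⟩)

theorem no_solution_e_ge_nine (e : ℕ) (he : 9 ≤ e) :
    ¬ ∃ x y z w : ℕ, 0 < x ∧ 0 < y ∧ 0 < z ∧ 0 < w ∧
      (4 ^ e - 1) ^ x + 4 ^ (e * y) + (4 ^ e + 1) ^ z = (4 ^ e + 2) ^ w := by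
  rintro ⟨x, y, z, w, hx, hy, hz, hw, h⟩
  rw [pow_mul] at h
  rcases Nat.lt_or_ge w (2 ^ 70) with h70 | h70
  · exact small_w e x y z w he hx hy hz hw h70 h
  · have h1 : 2 ^ Nat.log 2 w ≤ w := Nat.pow_log_le_self 2 hw.ne'
    have h2 : w < 2 ^ (Nat.log 2 w + 1) := Nat.lt_pow_succ_log_self (by norm_num) w
    have h3 : 70 ≤ Nat.log 2 w := Nat.le_log_of_pow_le (by norm_num) h70
    exact large_w e x y z w _ he hx hy hz hw h3 h1 h2 h
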